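/- Let g be an indecomposable symmetrizable Kac-Moody algebra of finite, affine or hyperbolic type, finitely Σ-graded with grading subalgebra m, with adapted root basis Π_a and J = {i∈I : ρ_a(α_i)=0}. Then I'_im = ∅, and (I,J) is a C-admissible pair. -/

import Mathlib

attribute [local instance] Classical.propDecidable

noncomputable section

namespace KMG

open Module

/-! ### Generalized Cartan matrices -/

/-- `A` is a generalized Cartan matrix. -/
def IsGCM {I : Type*} (A : Matrix I I ℤ) : Prop :=
  (∀ i, A i i = 2) ∧ (∀ i j, i ≠ j → A i j ≤ 0) ∧ ∀ i j, A i j = 0 → A j i = 0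

/-- `A` is indecomposable. -/
def Indecomposable {I : Type*} (A : Matrix I I ℤ) : Prop :=
  ∀ s : Set I, s.Nonempty → sᶜ.Nonempty → ∃ i ∈ s, ∃ j ∈ sᶜ, A i j ≠ 0

/-- `A` is symmetrizable: `D A` is symmetric for an invertible diagonal matrix `D`. -/
def Symmetrizable {I : Type*} (A : Matrix I I ℤ) : Prop :=
  ∃ d : I → ℚ, (∀ i, d i ≠ 0) ∧ ∀ i j, d i * (A i j : ℚ) = d j * (A j i : ℚ)

/-- The principal submatrix of `A` indexed by a subset `S`. -/
def restrictM {I : Type*} (A : Matrix I I ℤ) (S : Set I) : Matrix S S ℤ :=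
  fun i j => A i.1 j.1

/-- `A` is of finite type: `A u > 0` for some `u > 0` (Kac, Thm. 4.3). -/
def IsFiniteType {I : Type*} (A : Matrix I I ℤ) : Prop :=
  ∃ u : I → ℚ, (∀ i, 0 < u i) ∧ ∀ i, 0 < ∑ᶠ j, (A i j : ℚ) * u j

/-- `A` is of affine type: `A` indecomposable and `A u = 0` for some `u > 0`. -/
def IsAffineType {I : Type*} (A : Matrix I I ℤ) : Prop :=
  Indecomposable A ∧ ∃ u : I → ℚ, (∀ i, 0 < u i) ∧ ∀ i, ∑ᶠ j, (A i j : ℚ) * u j = 0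

/-- `A` is of indefinite type: `A u < 0` for some `u > 0`. -/
def IsIndefiniteType {I : Type*} (A : Matrix I I ℤ) : Prop :=
  ∃ u : I → ℚ, (∀ i, 0 < u i) ∧ ∀ i, ∑ᶠ j, (A i j : ℚ) * u j < 0

/-- The corank of a generalized Cartan matrix. -/
def gcmCorank {I : Type*} [Fintype I] [DecidableEq I] (A : Matrix I I ℤ) : ℕ :=
  Fintype.card I - (A.map ((↑) : ℤ → ℚ)).rank

/-- The connected component of the vertex `k` in the subdiagram of the Dynkin diagram of `A`
with vertex set `S`. -/
def cmpnt {I : Type*} (A : Matrix I I ℤ) (S : Set I) (k : I) : Set I :=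
  {i | i ∈ S ∧ Relation.ReflTransGen (fun x y => x ∈ S ∧ y ∈ S ∧ A x y ≠ 0) k i}

/-- `A` is hyperbolic: deleting any one vertex of the Dynkin diagram leaves a disjoint union
of diagrams of finite or affine type. -/
def IsHyperbolic {I : Type*} (A : Matrix I I ℤ) : Prop :=
  ∀ i₀ k : I, k ≠ i₀ →
    IsFiniteType (restrictM A (cmpnt A {i | i ≠ i₀} k)) ∨
      IsAffineType (restrictM A (cmpnt A {i | i ≠ i₀} k))

/-- `A` is Lorentzian: `A` is nonsingular and its symmetrization has signature `(+,...,+,-)`. -/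
def IsLorentzian {I : Type*} [Fintype I] [DecidableEq I] (A : Matrix I I ℤ) : Prop :=
  IsUnit (A.map ((↑) : ℤ → ℚ)).det ∧
    ∃ d : I → ℚ, (∀ i, 0 < d i) ∧ (∀ i j, d i * (A i j : ℚ) = d j * (A j i : ℚ)) ∧
      ∃ P : Matrix I I ℝ, IsUnit P.det ∧ ∃ i₀ : I,
        P.transpose * (Matrix.of fun i j => ((d i : ℝ) * (A i j : ℝ))) * P =
          Matrix.diagonal fun i => if i = i₀ then (-1 : ℝ) else 1

/-! ### Weight spaces -/

variable {g : Type*} [LieRing g] [LieAlgebra ℂ g]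

/-- The weight space of weight `χ` for the adjoint action on `g` of a space `V` mapping to `g`
by `ι`. -/
def wtSpaceι {V : Type*} [AddCommGroup V] [Module ℂ V] (ι : V →ₗ[ℂ] g)
    (χ : Module.Dual ℂ V) : Submodule ℂ g where
  carrier := {x | ∀ v : V, ⁅ι v, x⁆ = χ v • x}
  add_mem' := fun ha hb v => by rw [lie_add, ha v, hb v, smul_add]
  zero_mem' := fun v => by rw [lie_zero, smul_zero]
  smul_mem' := fun c x hx v => by rw [lie_smul, hx v, smul_comm]

/-! ### Kac-Moody algebras -/

/-- A (symmetrizable) Kac-Moody algebra structure on the Lie algebra `g`, for the generalized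
Cartan matrix `A` indexed by `I` : a realization `(H, root, coroot)` of `A` together with
Chevalley generators `e i`, `f i` satisfying the Chevalley-Serre relations, such that `g` is
generated by `H` and the `e i, f i`, is diagonalizable under `H`, with `0`-weight space `H`. -/
structure KacMoodyAlgebra {I : Type*} [Fintype I] [DecidableEq I] (A : Matrix I I ℤ)
    (g : Type*) [LieRing g] [LieAlgebra ℂ g] : Type _ where
  H : Submodule ℂ g
  root : I → Module.Dual ℂ H
  coroot : I → H
  e : I → g
  f : I → g
  findimH : FiniteDimensional ℂ H
  finrankH : Module.finrank ℂ H = Fintype.card I + gcmCorank A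
  indepRoot : LinearIndependent ℂ root
  indepCoroot : LinearIndependent ℂ coroot
  pairing : ∀ i j, root j (coroot i) = (A i j : ℂ)
  abelian : ∀ x y : H, ⁅(x : g), (y : g)⁆ = 0
  lie_e : ∀ (x : H) (i : I), ⁅(x : g), e i⁆ = root i x • e i
  lie_f : ∀ (x : H) (i : I), ⁅(x : g), f i⁆ = -(root i x) • f i
  e_f : ∀ i j, ⁅e i, f j⁆ = if j = i then ((coroot i : g)) else 0
  serre_e : ∀ i j, i ≠ j →
    ((LieAlgebra.ad ℂ g (e i)) ^ (1 - A i j).toNat) (e j) = 0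
  serre_f : ∀ i j, i ≠ j →
    ((LieAlgebra.ad ℂ g (f i)) ^ (1 - A i j).toNat) (f j) = 0
  generates : LieSubalgebra.lieSpan ℂ g ((H : Set g) ∪ Set.range e ∪ Set.range f) = ⊤
  weight_decomp : ⨆ χ : Module.Dual ℂ H, wtSpaceι H.subtype χ = ⊤
  zero_weight : wtSpaceι H.subtype (0 : Module.Dual ℂ H) = H

variable {I : Type*} [Fintype I] [DecidableEq I] {A : Matrix I I ℤ}

/-- The root system of a Kac-Moody algebra: nonzero weights of the adjoint action of the
Cartan subalgebra. -/
def Delta (G : KacMoodyAlgebra A g) : Set (Module.Dual ℂ G.H) :=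
  {χ | χ ≠ 0 ∧ wtSpaceι G.H.subtype χ ≠ ⊥}

/-- The positive roots with respect to the standard root basis. -/
def posRoots (G : KacMoodyAlgebra A g) : Set (Module.Dual ℂ G.H) :=
  {χ ∈ Delta G | ∃ c : I → ℕ, χ = ∑ i, (c i : ℂ) • G.root i}

/-- The real roots : the orbit of the simple roots under the Weyl group. -/
inductive IsRealRoot (G : KacMoodyAlgebra A g) : Module.Dual ℂ G.H → Prop
  | simple (i : I) : IsRealRoot G (G.root i)
  | reflect (i : I) (χ : Module.Dual ℂ G.H) :
      IsRealRoot G χ → IsRealRoot G (χ - χ (G.coroot i) • G.root i)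

/-- The subalgebra `g(S)` generated by the root spaces `g_{± α_i}`, `i ∈ S`. -/
def gS (G : KacMoodyAlgebra A g) (S : Set I) : LieSubalgebra ℂ g :=
  LieSubalgebra.lieSpan ℂ g ({x | ∃ i ∈ S, x = G.e i} ∪ {x | ∃ i ∈ S, x = G.f i})

/-- The subspace `h^J = {h ∈ h | ⟨α_j, h⟩ = 0 ∀ j ∈ J}`. -/
def hJsub (G : KacMoodyAlgebra A g) (J : Set I) : Submodule ℂ G.H :=
  ⨅ j ∈ J, LinearMap.ker (G.root j)

/-- `Hk` is the canonical semisimple element attached to `k` and the component `S = I_k` :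
it lies in the span of the coroots from `S` and satisfies `⟨α_i, H_k⟩ = 2 δ_{i,k}` on `S`. -/
def IsHGen (G : KacMoodyAlgebra A g) (S : Set I) (k : I) (Hk : G.H) : Prop :=
  Hk ∈ Submodule.span ℂ (G.coroot '' S) ∧
    ∀ i ∈ S, G.root i Hk = if i = k then 2 else 0

/-- `g(S)` is `A₁`-graded by the `sl₂`-triple with semisimple element `Hk` :
`ad Hk` has only eigenvalues `0, 2, -2` on `g(S)`. -/
def A1GradedBy (G : KacMoodyAlgebra A g) (S : Set I) (Hk : g) : Prop :=
  ∀ x ∈ gS G S, x ∈ Module.End.eigenspace (LieAlgebra.ad ℂ g Hk) 0 ⊔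
    Module.End.eigenspace (LieAlgebra.ad ℂ g Hk) 2 ⊔
      Module.End.eigenspace (LieAlgebra.ad ℂ g Hk) (-2)

/-- The pair `(I_k, J_k)` (for `I_k` the connected component of `k` in `J ∪ {k}`) is an
irreducible `C`-admissible pair. -/
def CAdmissibleComponent (G : KacMoodyAlgebra A g) (J : Set I) (k : I) : Prop :=
  IsFiniteType (restrictM A (cmpnt A (J ∪ {k}) k)) ∧
    ∃ Hk : G.H, IsHGen G (cmpnt A (J ∪ {k}) k) k Hk ∧
      ∃ E F : g, E ∈ gS G (cmpnt A (J ∪ {k}) k) ∧ F ∈ gS G (cmpnt A (J ∪ {k}) k) ∧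
        IsSl2Triple (Hk : g) E F ∧ A1GradedBy G (cmpnt A (J ∪ {k}) k) (Hk : g)

/-- The data of a `C`-admissible pair `(I, J)` : for each `k ∉ J`, the component `I_k` is of
finite type and carries an `sl₂`-triple `(E_k, H_k, F_k)` which `A₁`-grades `g(I_k)`. -/
structure CAdmissibleData (G : KacMoodyAlgebra A g) (J : Set I) : Type _ where
  finJ : IsFiniteType (restrictM A J)
  Hc : {k : I // k ∉ J} → G.H
  E : {k : I // k ∉ J} → g
  F : {k : I // k ∉ J} → g
  finIk : ∀ k : {k : I // k ∉ J}, IsFiniteType (restrictM A (cmpnt A (J ∪ {k.1}) k.1))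
  isHGen : ∀ k, IsHGen G (cmpnt A (J ∪ {k.1}) k.1) k.1 (Hc k)
  memE : ∀ k, E k ∈ gS G (cmpnt A (J ∪ {k.1}) k.1)
  memF : ∀ k, F k ∈ gS G (cmpnt A (J ∪ {k.1}) k.1)
  sl2 : ∀ k, IsSl2Triple ((Hc k : g)) (E k) (F k)
  a1 : ∀ k, A1GradedBy G (cmpnt A (J ∪ {k.1}) k.1) ((Hc k : g))

/-- `(I,J)` is a `C`-admissible pair. -/
def CAdmissiblePair (G : KacMoodyAlgebra A g) (J : Set I) : Prop :=
  Nonempty (CAdmissibleData G J)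

/-- The data of a `C`-admissible pair `(Itot, J)` for a subdiagram `Itot ⊆ I`. -/
structure CAdmissibleDataIn (G : KacMoodyAlgebra A g) (Itot J : Set I) : Type _ where
  subJ : J ⊆ Itot
  finJ : IsFiniteType (restrictM A J)
  Hc : {k : I // k ∈ Itot ∧ k ∉ J} → G.H
  E : {k : I // k ∈ Itot ∧ k ∉ J} → g
  F : {k : I // k ∈ Itot ∧ k ∉ J} → g
  finIk : ∀ k : {k : I // k ∈ Itot ∧ k ∉ J},
    IsFiniteType (restrictM A (cmpnt A (J ∪ {k.1}) k.1))
  isHGen : ∀ k, IsHGen G (cmpnt A (J ∪ {k.1}) k.1) k.1 (Hc k)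
  memE : ∀ k, E k ∈ gS G (cmpnt A (J ∪ {k.1}) k.1)
  memF : ∀ k, F k ∈ gS G (cmpnt A (J ∪ {k.1}) k.1)
  sl2 : ∀ k, IsSl2Triple ((Hc k : g)) (E k) (F k)
  a1 : ∀ k, A1GradedBy G (cmpnt A (J ∪ {k.1}) k.1) ((Hc k : g))

/-- The `C`-admissible subalgebra `g^J` : generated by `h^J` and the `E_k, F_k`. -/
def CAdmissibleData.gJ {G : KacMoodyAlgebra A g} {J : Set I} (D : CAdmissibleData G J) :
    LieSubalgebra ℂ g :=
  LieSubalgebra.lieSpan ℂ g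
    ((((hJsub G J).map G.H.subtype : Submodule ℂ g) : Set g) ∪ Set.range D.E ∪ Set.range D.F)

/-- `GJ` is "the" Kac-Moody structure on `g^J` associated to a `C`-admissible pair: its
Cartan subalgebra is `h^J`, its coroots are the `H_k` and its Chevalley generators are the
`E_k, F_k`; the matrix `A'` is `A^J`, i.e. `a'_{k,l} = ⟨α_l, H_k⟩`. -/
def CAdmissibleData.IsAssocKM {G : KacMoodyAlgebra A g} {J : Set I} (D : CAdmissibleData G J)
    {A' : Matrix {k : I // k ∉ J} {k : I // k ∉ J} ℤ}
    (GJ : KacMoodyAlgebra A' ↥D.gJ) : Prop :=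
  (∀ k l, (A' k l : ℂ) = G.root l.1 (D.Hc k)) ∧
  GJ.H.map D.gJ.toSubmodule.subtype = (hJsub G J).map G.H.subtype ∧
  (∀ k, ((GJ.coroot k : ↥D.gJ) : g) = ((D.Hc k : ↥G.H) : g)) ∧
  (∀ k, ((GJ.e k : ↥D.gJ) : g) = D.E k) ∧ (∀ k, ((GJ.f k : ↥D.gJ) : g) = D.F k)

/-! ### Finite gradations -/

/-- `g` is finitely `Σ`-graded, where `Σ` is the root system of the Kac-Moody algebra `m`
(with Kac-Moody structure `M`) and `m` is embedded in `g` by `φ` (the grading subalgebra is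
the image of `φ`): `g` is the sum of the weight spaces `V_γ`, `γ ∈ Σ ∪ {0}`, of the adjoint
action of the Cartan subalgebra of `m`, and each `V_γ` is finite dimensional. -/
def IsFinGrading {S : Type*} [Fintype S] [DecidableEq S] {B : Matrix S S ℤ}
    {m : Type*} [LieRing m] [LieAlgebra ℂ m] (M : KacMoodyAlgebra B m)
    (φ : m →ₗ⁅ℂ⁆ g) : Prop :=
  Function.Injective φ ∧
  (⨆ χ ∈ insert (0 : Module.Dual ℂ M.H) (Delta M),
      wtSpaceι (φ.toLinearMap ∘ₗ M.H.subtype) χ) = ⊤ ∧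
  ∀ χ ∈ insert (0 : Module.Dual ℂ M.H) (Delta M),
      FiniteDimensional ℂ (wtSpaceι (φ.toLinearMap ∘ₗ M.H.subtype) χ)

section Grading

variable {S : Type*} [Fintype S] [DecidableEq S] {B : Matrix S S ℤ}
variable {m : Type*} [LieRing m] [LieAlgebra ℂ m]

/-- The inclusion of the Cartan subalgebra of the grading subalgebra into the Cartan
subalgebra of `g` (given `a ⊆ h`). -/
def cartanIncl (G : KacMoodyAlgebra A g) (M : KacMoodyAlgebra B m) (φ : m →ₗ⁅ℂ⁆ g)
    (hle : M.H.map φ.toLinearMap ≤ G.H) : M.H →ₗ[ℂ] G.H :=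
  LinearMap.codRestrict G.H (φ.toLinearMap ∘ₗ M.H.subtype)
    (fun x => hle (Submodule.mem_map_of_mem x.2))

/-- The restriction `ρ_a(χ)` to the Cartan subalgebra `a` of `m` of a linear form `χ` on `h`. -/
def resD (G : KacMoodyAlgebra A g) (M : KacMoodyAlgebra B m) (φ : m →ₗ⁅ℂ⁆ g)
    (hle : M.H.map φ.toLinearMap ≤ G.H) (χ : Module.Dual ℂ G.H) : Module.Dual ℂ M.H :=
  χ.comp (cartanIncl G M φ hle)

/-- The restriction `ρ_a(α_i)` of the simple root `α_i` to `a`. -/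
def resRoot (G : KacMoodyAlgebra A g) (M : KacMoodyAlgebra B m) (φ : m →ₗ⁅ℂ⁆ g)
    (hle : M.H.map φ.toLinearMap ≤ G.H) (i : I) : Module.Dual ℂ M.H :=
  resD G M φ hle (G.root i)

/-- The root basis of `M` is adapted to the root basis of `G` :
`ρ_a(Δ⁺) ⊆ Σ⁺ ∪ {0}`. -/
def Adapted (G : KacMoodyAlgebra A g) (M : KacMoodyAlgebra B m) (φ : m →ₗ⁅ℂ⁆ g)
    (hle : M.H.map φ.toLinearMap ≤ G.H) : Prop :=
  ∀ χ ∈ posRoots G, resD G M φ hle χ = 0 ∨ resD G M φ hle χ ∈ posRoots M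

/-- The set `J = {i ∈ I | ρ_a(α_i) = 0}`. -/
def Jof (G : KacMoodyAlgebra A g) (M : KacMoodyAlgebra B m) (φ : m →ₗ⁅ℂ⁆ g)
    (hle : M.H.map φ.toLinearMap ≤ G.H) : Set I :=
  {i | resRoot G M φ hle i = 0}

/-- The set `Γ_s = {i ∈ I' | ρ_a(α_i) = γ_s}`. -/
def GammaOf (G : KacMoodyAlgebra A g) (M : KacMoodyAlgebra B m) (φ : m →ₗ⁅ℂ⁆ g)
    (hle : M.H.map φ.toLinearMap ≤ G.H) (s : S) : Set I :=
  {i | resRoot G M φ hle i = M.root s}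

/-- The set `I'_re = {i ∈ I' | ρ_a(α_i) ∈ Π_a}`. -/
def IpRe (G : KacMoodyAlgebra A g) (M : KacMoodyAlgebra B m) (φ : m →ₗ⁅ℂ⁆ g)
    (hle : M.H.map φ.toLinearMap ≤ G.H) : Set I :=
  {i | ∃ s : S, resRoot G M φ hle i = M.root s}

/-- The set `I'_im = {i ∈ I | ρ_a(α_i) ∉ Π_a ∪ {0}}`. -/
def IpIm (G : KacMoodyAlgebra A g) (M : KacMoodyAlgebra B m) (φ : m →ₗ⁅ℂ⁆ g)
    (hle : M.H.map φ.toLinearMap ≤ G.H) : Set I :=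
  {i | resRoot G M φ hle i ≠ 0 ∧ ∀ s : S, resRoot G M φ hle i ≠ M.root s}

/-- The set `I_re` : union of the components `I_k`, `k ∈ I'_re`. -/
def IreOf (G : KacMoodyAlgebra A g) (M : KacMoodyAlgebra B m) (φ : m →ₗ⁅ℂ⁆ g)
    (hle : M.H.map φ.toLinearMap ≤ G.H) : Set I :=
  {i | ∃ k ∈ IpRe G M φ hle, i ∈ cmpnt A (Jof G M φ hle ∪ {k}) k}

/-- `g` is maximally finitely graded: finitely graded, with `a ⊆ h`, the root basis of the
grading subalgebra adapted, and the corresponding sets `J` and `I'_im` empty. -/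
def MaxFinGrading (G : KacMoodyAlgebra A g) (M : KacMoodyAlgebra B m) (φ : m →ₗ⁅ℂ⁆ g) : Prop :=
  IsFinGrading M φ ∧ ∃ hle : M.H.map φ.toLinearMap ≤ G.H,
    Adapted G M φ hle ∧ Jof G M φ hle = ∅ ∧ IpIm G M φ hle = ∅

end Grading

/-- `(π, πv)` is a root basis (with generalized Cartan matrix `B`) of the root system `Rts`. -/
def IsRootBasis {V : Type*} [AddCommGroup V] [Module ℂ V] {S : Type*} [Fintype S]
    (B : Matrix S S ℤ) (Rts : Set (Module.Dual ℂ V)) (π : S → Module.Dual ℂ V)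
    (πv : S → V) : Prop :=
  LinearIndependent ℂ π ∧ LinearIndependent ℂ πv ∧
  (∀ s t, π t (πv s) = (B s t : ℂ)) ∧ (∀ s, π s ∈ Rts) ∧
  ∀ χ ∈ Rts, (∃ c : S → ℕ, χ = ∑ s, (c s : ℂ) • π s) ∨
    (∃ c : S → ℕ, χ = -∑ s, (c s : ℂ) • π s)

/-- `Bf` is a nondegenerate invariant symmetric bilinear form on `g`. -/
def InvariantForm (Bf : g →ₗ[ℂ] g →ₗ[ℂ] ℂ) : Prop :=
  (∀ x y, Bf x y = Bf y x) ∧ (∀ x y z, Bf ⁅x, y⁆ z = Bf x ⁅y, z⁆) ∧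
  ∀ x, (∀ y, Bf x y = 0) → x = 0

/-- `Bf` is "the" invariant bilinear form of the Kac-Moody algebra `G` : nondegenerate,
invariant, symmetric, with `(α_i∨, α_i∨)` a positive rational for all `i`. -/
def NormalizedInvForm (G : KacMoodyAlgebra A g) (Bf : g →ₗ[ℂ] g →ₗ[ℂ] ℂ) : Prop :=
  InvariantForm Bf ∧ ∀ i : I, ∃ q : ℚ, 0 < q ∧ Bf ((G.coroot i : g)) ((G.coroot i : g)) = (q : ℂ)

/-- `(e', f')` is a system of Chevalley generators for `G` (with the given Cartan subalgebra,
simple roots and coroots). -/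
def IsChevalleyGens (G : KacMoodyAlgebra A g) (e' f' : I → g) : Prop :=
  (∀ (x : G.H) (i : I), ⁅(x : g), e' i⁆ = G.root i x • e' i) ∧
  (∀ (x : G.H) (i : I), ⁅(x : g), f' i⁆ = -(G.root i x) • f' i) ∧
  (∀ i j, ⁅e' i, f' j⁆ = if j = i then ((G.coroot i : g)) else 0) ∧
  (∀ i j, i ≠ j → ((LieAlgebra.ad ℂ g (e' i)) ^ (1 - A i j).toNat) (e' j) = 0) ∧
  (∀ i j, i ≠ j → ((LieAlgebra.ad ℂ g (f' i)) ^ (1 - A i j).toNat) (f' j) = 0) ∧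
  LieSubalgebra.lieSpan ℂ g ((G.H : Set g) ∪ Set.range e' ∪ Set.range f') = ⊤


/-- The subalgebra `g(I_re)` of `g` generated by `h_{I_re}` and the `e_i, f_i`, `i ∈ I_re`. -/
def gIre (G : KacMoodyAlgebra A g) (Ire : Set I) (hIre : Submodule ℂ g) : LieSubalgebra ℂ g :=
  LieSubalgebra.lieSpan ℂ g
    ((hIre : Set g) ∪ {x | ∃ i ∈ Ire, x = G.e i} ∪ {x | ∃ i ∈ Ire, x = G.f i})

/-- `GI` is "the" Kac-Moody structure on `g(I_re)` : its Cartan subalgebra is `h_{I_re}`,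
its coroots and Chevalley generators are the `α_i∨, e_i, f_i` of `g`, for `i ∈ I_re`. -/
def IsAssocKMIre (G : KacMoodyAlgebra A g) (Ire : Set I) (hIre : Submodule ℂ g)
    {A'' : Matrix ↥Ire ↥Ire ℤ} (GI : KacMoodyAlgebra A'' ↥(gIre G Ire hIre)) : Prop :=
  GI.H.map (gIre G Ire hIre).toSubmodule.subtype = hIre ∧
  (∀ i, ((GI.coroot i : ↥(gIre G Ire hIre)) : g) = ((G.coroot i.1 : ↥G.H) : g)) ∧
  (∀ i, ((GI.e i : ↥(gIre G Ire hIre)) : g) = G.e i.1) ∧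
  (∀ i, ((GI.f i : ↥(gIre G Ire hIre)) : g) = G.f i.1)

/-! ### Admissible quotients and maximal gradations -/

/-- `ρ : I → S` is an admissible quotient map for `A` : fibers are totally disconnected (MG1)
and the column sums over a fiber are constant along fibers (MG2). -/
def AdmissibleQuotient {I S : Type*} (A : Matrix I I ℤ) (ρ : I → S) : Prop :=
  Function.Surjective ρ ∧
  (∀ k l, k ≠ l → ρ k = ρ l → A k l = 0) ∧
  ∀ s t : S, s ≠ t → ∀ j j', ρ j = t → ρ j' = t →
    ∑ᶠ i ∈ {i | ρ i = s}, A i j = ∑ᶠ i ∈ {i | ρ i = s}, A i j'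

section Quotient

variable {S : Type*} [Fintype S] [DecidableEq S]

/-- `γ_s∨ = ∑_{k ∈ Γ_s} α_k∨`. -/
def gammaV (G : KacMoodyAlgebra A g) (ρ : I → S) (s : S) : G.H :=
  ∑ᶠ k ∈ {k | ρ k = s}, G.coroot k

/-- `X̄_s = ∑_{k ∈ Γ_s} e_k`. -/
def Xbar (G : KacMoodyAlgebra A g) (ρ : I → S) (s : S) : g :=
  ∑ᶠ k ∈ {k | ρ k = s}, G.e k

/-- `Ȳ_s = ∑_{k ∈ Γ_s} f_k`. -/
def Ybar (G : KacMoodyAlgebra A g) (ρ : I → S) (s : S) : g :=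
  ∑ᶠ k ∈ {k | ρ k = s}, G.f k

/-- The subalgebra `g^ρ` generated by `a` and the `X̄_s, Ȳ_s`. -/
def gRho (G : KacMoodyAlgebra A g) (ρ : I → S) (a : Submodule ℂ G.H) : LieSubalgebra ℂ g :=
  LieSubalgebra.lieSpan ℂ g
    (((a.map G.H.subtype : Submodule ℂ g) : Set g) ∪ Set.range (Xbar G ρ) ∪
      Set.range (Ybar G ρ))

/-- `Gρ` is "the" Kac-Moody structure on `g^ρ` : its Cartan subalgebra is `a`, its coroots
are the `γ_s∨` and its Chevalley generators are the `X̄_s, Ȳ_s`. -/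
def IsAssocKMrho (G : KacMoodyAlgebra A g) (ρ : I → S) (a : Submodule ℂ G.H)
    {Abar : Matrix S S ℤ} (Gρ : KacMoodyAlgebra Abar ↥(gRho G ρ a)) : Prop :=
  Gρ.H.map (gRho G ρ a).toSubmodule.subtype = a.map G.H.subtype ∧
  (∀ s, ((Gρ.coroot s : ↥(gRho G ρ a)) : g) = ((gammaV G ρ s : ↥G.H) : g)) ∧
  (∀ s, ((Gρ.e s : ↥(gRho G ρ a)) : g) = Xbar G ρ s) ∧
  (∀ s, ((Gρ.f s : ↥(gRho G ρ a)) : g) = Ybar G ρ s)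

end Quotient

end KMG

namespace KMG

open Module

section WeightSpaces

variable {g : Type*} [LieRing g] [LieAlgebra ℂ g] {V : Type*} [AddCommGroup V] [Module ℂ V]

lemma iSupIndep_wtSpaceι (ι : V →ₗ[ℂ] g) : iSupIndep (wtSpaceι ι) := by
  rw [iSupIndep_iff_finsetSum_eq_zero_imp_eq_zero]
  intro s
  induction s using Finset.induction_on with
  | empty => simp
  | insert χ₀ s hχ₀ ih =>
    intro x hx hsum
    have hs : ∀ χ ∈ s, x χ = 0 := by
      intro χ hχ
      obtain ⟨v, hv⟩ : ∃ v, χ v ≠ χ₀ v := by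
        by_contra! h
        exact hχ₀ (LinearMap.ext h ▸ hχ)
      have key := ih (fun ψ => (ψ v - χ₀ v) • x ψ)
        (fun ψ hψ => Submodule.smul_mem _ _ (hx ψ (Finset.mem_insert_of_mem hψ))) (by
          have h1 : ⁅ι v, ∑ ψ ∈ insert χ₀ s, x ψ⁆ - χ₀ v • ∑ ψ ∈ insert χ₀ s, x ψ = 0 := by
            rw [hsum]; simp
          rw [lie_sum, Finset.smul_sum, ← Finset.sum_sub_distrib] at h1
          rw [Finset.sum_congr rfl (g := fun ψ => (ψ v - χ₀ v) • x ψ)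
            (fun ψ hψ => by rw [hx ψ hψ v, sub_smul])] at h1
          rw [Finset.sum_insert hχ₀] at h1
          simpa using h1) χ hχ
      exact (smul_eq_zero.mp key).resolve_left (sub_ne_zero.mpr hv)
    intro χ hχ
    rcases Finset.mem_insert.mp hχ with rfl | h
    · rw [Finset.sum_insert hχ₀, Finset.sum_eq_zero hs, add_zero] at hsum
      exact hsum
    · exact hs χ h

/-- The sum of the weight spaces with weight in `P`. -/
def wtSum (ι : V →ₗ[ℂ] g) (P : Set (Dual ℂ V)) : Submodule ℂ g := ⨆ χ ∈ P, wtSpaceι ι χ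

variable {ι : V →ₗ[ℂ] g} {P Q R : Set (Dual ℂ V)}

lemma wtSpaceι_le_wtSum {χ : Dual ℂ V} (h : χ ∈ P) : wtSpaceι ι χ ≤ wtSum ι P :=
  le_iSup₂_of_le χ h le_rfl

lemma wtSum_le {N : Submodule ℂ g} : wtSum ι P ≤ N ↔ ∀ χ ∈ P, wtSpaceι ι χ ≤ N := iSup₂_le_iff

lemma wtSum_mono (h : P ⊆ Q) : wtSum ι P ≤ wtSum ι Q :=
  wtSum_le.mpr fun _ hχ => wtSpaceι_le_wtSum (h hχ)

lemma disjoint_wtSum (h : Disjoint P Q) : Disjoint (wtSum ι P) (wtSum ι Q) :=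
  (iSupIndep_wtSpaceι ι).disjoint_biSup_biSup h

lemma eq_zero_of_mem_wtSum {x : g} (h : Disjoint P Q) (hP : x ∈ wtSum ι P)
    (hQ : x ∈ wtSum ι Q) : x = 0 :=
  Submodule.disjoint_def.mp (disjoint_wtSum h) x hP hQ

lemma lie_mem_wtSpaceι {χ ψ : Dual ℂ V} {x y : g} (hx : x ∈ wtSpaceι ι χ)
    (hy : y ∈ wtSpaceι ι ψ) : ⁅x, y⁆ ∈ wtSpaceι ι (χ + ψ) := fun v => by
  rw [leibniz_lie, hx v, hy v, smul_lie, lie_smul, ← add_smul]; rfl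

lemma lie_mem_wtSum (h : ∀ χ ∈ P, ∀ ψ ∈ Q, χ + ψ ∈ R) {x y : g} (hx : x ∈ wtSum ι P)
    (hy : y ∈ wtSum ι Q) : ⁅x, y⁆ ∈ wtSum ι R := by
  have h1 : wtSum ι P ≤ (wtSum ι R).comap (LieAlgebra.ad ℂ g y : g →ₗ[ℂ] g) := by
    refine wtSum_le.mpr fun χ hχ a ha => ?_
    have h2 : wtSum ι Q ≤ (wtSum ι R).comap (LieAlgebra.ad ℂ g a : g →ₗ[ℂ] g) :=
      wtSum_le.mpr fun ψ hψ b hb =>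
        wtSpaceι_le_wtSum (h χ hχ ψ hψ) (lie_mem_wtSpaceι ha hb)
    have h3 : ⁅a, y⁆ ∈ wtSum ι R := h2 hy
    rw [Submodule.mem_comap, LieAlgebra.ad_apply, ← lie_skew]
    exact neg_mem h3
  have h4 : ⁅y, x⁆ ∈ wtSum ι R := h1 hx
  rw [← lie_skew]
  exact neg_mem h4

/-- If `N` lies in the sum of the weight spaces for `P`, and `N` together with weight spaces for
weights outside `P` spans `g`, then `N` is the sum of the weight spaces for `P`. -/
lemma wtSum_le_of_top_le {N : Submodule ℂ g} (hN : N ≤ wtSum ι P) (hPQ : Disjoint P Q)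
    (htop : ⊤ ≤ N ⊔ wtSum ι Q) : wtSum ι P ≤ N := by
  intro x hx
  obtain ⟨p, hp, q, hq, rfl⟩ := Submodule.mem_sup.mp (htop (Submodule.mem_top (x := x)))
  have : q = 0 := eq_zero_of_mem_wtSum hPQ (by simpa using sub_mem hx (hN hp)) hq
  simpa [this] using hp

end WeightSpaces

section Structure

variable {I : Type*} [Fintype I] [DecidableEq I] {A : Matrix I I ℤ}
variable {g : Type*} [LieRing g] [LieAlgebra ℂ g]

namespace KacMoodyAlgebra

/-- The Kac-Moody structure obtained by exchanging the roles of the `e i` and the `f i`. -/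
@[reducible] def op (G : KacMoodyAlgebra A g) : KacMoodyAlgebra A g where
  H := G.H
  root i := -G.root i
  coroot i := -G.coroot i
  e := G.f
  f := G.e
  findimH := G.findimH
  finrankH := G.finrankH
  indepRoot := by
    convert G.indepRoot.units_smul (fun _ => (-1 : ℂˣ)) using 2
    simp
  indepCoroot := by
    convert G.indepCoroot.units_smul (fun _ => (-1 : ℂˣ)) using 2
    simp
  pairing i j := by simp [G.pairing]
  abelian := G.abelian
  lie_e x i := by simpa using G.lie_f x i
  lie_f x i := by simpa using G.lie_e x i
  e_f i j := by
    rw [← lie_skew, G.e_f]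
    by_cases h : j = i
    · simp [h]
    · simp [h, Ne.symm h]
  serre_e := G.serre_f
  serre_f := G.serre_e
  generates := by
    rw [Set.union_right_comm]; exact G.generates
  weight_decomp := G.weight_decomp
  zero_weight := G.zero_weight

/-- The element of the root lattice with given coordinates. -/
def lat (G : KacMoodyAlgebra A g) (c : I → ℤ) : Dual ℂ G.H := ∑ i, (c i : ℂ) • G.root i

/-- The nonzero nonnegative integral combinations of the simple roots indexed by `K`. -/
def cone (G : KacMoodyAlgebra A g) (K : Set I) : Set (Dual ℂ G.H) :=
  {χ | ∃ c : I → ℤ, 0 ≤ c ∧ c ≠ 0 ∧ (∀ i ∉ K, c i = 0) ∧ χ = G.lat c}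

/-- The subalgebra generated by the `e i`, `i ∈ K`. -/
def nPos (G : KacMoodyAlgebra A g) (K : Set I) : LieSubalgebra ℂ g :=
  LieSubalgebra.lieSpan ℂ g {x | ∃ i ∈ K, x = G.e i}

/-- The weight space of weight `χ`. -/
abbrev ws (G : KacMoodyAlgebra A g) (χ : Dual ℂ G.H) : Submodule ℂ g := wtSpaceι G.H.subtype χ

variable (G : KacMoodyAlgebra A g)

lemma lat_add (c d : I → ℤ) : G.lat (c + d) = G.lat c + G.lat d := by
  simp [lat, add_smul, Finset.sum_add_distrib]

lemma lat_neg (c : I → ℤ) : G.lat (-c) = -G.lat c := by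
  simp [lat]

lemma lat_sub (c d : I → ℤ) : G.lat (c - d) = G.lat c - G.lat d := by
  rw [sub_eq_add_neg, lat_add, lat_neg, sub_eq_add_neg]

lemma lat_zero : G.lat 0 = 0 := by simp [lat]

lemma lat_smul (n : ℤ) (c : I → ℤ) : G.lat (n • c) = (n : ℂ) • G.lat c := by
  simp [lat, Finset.smul_sum, mul_smul]

lemma lat_single (i : I) : G.lat (Pi.single i 1) = G.root i := by
  rw [lat, Finset.sum_eq_single i] <;> simp +contextual

lemma op_lat (c : I → ℤ) : G.op.lat c = -G.lat c := by
  simp [lat]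

lemma lat_injective : Function.Injective G.lat := by
  intro c d h
  have h1 : ∑ i, ((c i : ℂ) - d i) • G.root i = 0 := by
    have := sub_eq_zero.mpr h
    simpa [lat, sub_smul, Finset.sum_sub_distrib] using this
  funext i
  have := Fintype.linearIndependent_iff.mp G.indepRoot _ h1 i
  exact_mod_cast sub_eq_zero.mp this

lemma lat_apply_coroot (c : I → ℤ) (i : I) :
    G.lat c (G.coroot i) = ((∑ j, A i j * c j : ℤ) : ℂ) := by
  simp [lat, G.pairing, mul_comm]

lemma e_mem_ws (i : I) : G.e i ∈ G.ws (G.root i) := fun x => G.lie_e x i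

lemma f_mem_ws (i : I) : G.f i ∈ G.ws (-G.root i) := fun x => G.lie_f x i

lemma mem_H_iff (x : g) : x ∈ G.H ↔ x ∈ G.ws 0 := by rw [ws, G.zero_weight]

lemma root_mem_cone {i : I} {K : Set I} (hi : i ∈ K) : G.root i ∈ G.cone K := by
  refine ⟨Pi.single i 1, ?_, ?_, ?_, (G.lat_single i).symm⟩
  · intro j; by_cases h : j = i <;> simp [h]
  · simp
  · intro j hj
    have : j ≠ i := fun h => hj (h ▸ hi)
    simp [this]

lemma cone_add {K : Set I} {χ ψ : Dual ℂ G.H} (hχ : χ ∈ G.cone K) (hψ : ψ ∈ G.cone K) :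
    χ + ψ ∈ G.cone K := by
  obtain ⟨c, hc, hc0, hcK, rfl⟩ := hχ
  obtain ⟨d, hd, -, hdK, rfl⟩ := hψ
  refine ⟨c + d, add_nonneg hc hd, ?_, fun i hi => by simp [hcK i hi, hdK i hi],
    (G.lat_add c d).symm⟩
  contrapose! hc0
  exact le_antisymm (fun i => by have := congrFun hc0 i; have := hd i; simp at *; linarith) hc

lemma cone_mono {K L : Set I} (h : K ⊆ L) : G.cone K ⊆ G.cone L := by
  rintro _ ⟨c, hc, hc0, hcK, rfl⟩
  exact ⟨c, hc, hc0, fun i hi => hcK i fun h' => hi (h h'), rfl⟩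

lemma e_mem_nPos {i : I} {K : Set I} (hi : i ∈ K) : G.e i ∈ G.nPos K :=
  LieSubalgebra.subset_lieSpan ⟨i, hi, rfl⟩

lemma nPos_le_wtSum (K : Set I) :
    (G.nPos K).toSubmodule ≤ wtSum G.H.subtype (G.cone K) := by
  intro x hx
  induction hx using LieSubalgebra.lieSpan_induction with
  | mem y h =>
    obtain ⟨i, hi, rfl⟩ := h
    exact wtSpaceι_le_wtSum (G.root_mem_cone hi) (G.e_mem_ws i)
  | zero => exact zero_mem _
  | add _ _ _ _ hu hv => exact add_mem hu hv
  | smul t _ _ hu => exact Submodule.smul_mem _ t hu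
  | lie _ _ _ _ hu hv => exact lie_mem_wtSum (fun _ h _ h' => G.cone_add h h') hu hv

lemma lie_H_nPos {K : Set I} {h x : g} (hh : h ∈ G.H) (hx : x ∈ G.nPos K) :
    ⁅h, x⁆ ∈ G.nPos K := by
  induction hx using LieSubalgebra.lieSpan_induction with
  | mem y hy =>
    obtain ⟨i, hi, rfl⟩ := hy
    rw [G.lie_e ⟨h, hh⟩ i]
    exact (G.nPos K).smul_mem _ (G.e_mem_nPos hi)
  | zero => simp
  | add _ _ _ _ hu hv => rw [lie_add]; exact add_mem hu hv
  | smul t _ _ hu => rw [lie_smul]; exact (G.nPos K).smul_mem t hu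
  | lie x y hx hy hu hv =>
    rw [leibniz_lie]
    exact add_mem ((G.nPos K).lie_mem hu hy) ((G.nPos K).lie_mem hx hv)

/-- The sum of a subspace `T` of the Cartan subalgebra and the subalgebras generated by the
`e i`, resp. the `f i`, `i ∈ K`. -/
def tri (T : Submodule ℂ g) (K : Set I) : Submodule ℂ g :=
  T ⊔ (G.nPos K).toSubmodule ⊔ (G.op.nPos K).toSubmodule

lemma lie_f_nPos {T : Submodule ℂ g} {K : Set I} (hT : T ≤ G.H)
    (hc : ∀ i ∈ K, (G.coroot i : g) ∈ T) (i : I) {x : g} (hx : x ∈ G.nPos K) :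
    ⁅G.f i, x⁆ ∈ T ⊔ (G.nPos K).toSubmodule := by
  have aux : ∀ a ∈ T ⊔ (G.nPos K).toSubmodule, ∀ b ∈ G.nPos K,
      ⁅a, b⁆ ∈ T ⊔ (G.nPos K).toSubmodule := by
    intro a ha b hb
    obtain ⟨t, ht, n, hn, rfl⟩ := Submodule.mem_sup.mp ha
    rw [add_lie]
    exact Submodule.mem_sup_right (add_mem (G.lie_H_nPos (hT ht) hb) ((G.nPos K).lie_mem hn hb))
  induction hx using LieSubalgebra.lieSpan_induction with
  | mem y hy =>
    obtain ⟨j, hj, rfl⟩ := hy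
    rw [← lie_skew, G.e_f]
    refine neg_mem (Submodule.mem_sup_left ?_)
    split_ifs
    · exact hc j hj
    · exact zero_mem _
  | zero => simp
  | add _ _ _ _ hu hv => rw [lie_add]; exact add_mem hu hv
  | smul t _ _ hu => rw [lie_smul]; exact Submodule.smul_mem _ t hu
  | lie x y hx hy hu hv =>
    rw [leibniz_lie]
    refine add_mem (aux _ hu _ hy) ?_
    rw [← lie_skew]
    exact neg_mem (aux _ hv _ hx)

lemma lie_e_tri {T : Submodule ℂ g} {K : Set I} (hT : T ≤ G.H)
    (hc : ∀ i ∈ K, (G.coroot i : g) ∈ T) {i : I} (hi : i ∈ K) {x : g} (hx : x ∈ G.tri T K) :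
    ⁅G.e i, x⁆ ∈ G.tri T K := by
  obtain ⟨y, hy, n, hn, rfl⟩ := Submodule.mem_sup.mp hx
  obtain ⟨t, ht, p, hp, rfl⟩ := Submodule.mem_sup.mp hy
  rw [lie_add, lie_add]
  refine add_mem (add_mem ?_ ?_) ?_
  · rw [← lie_skew]
    exact Submodule.mem_sup_left (Submodule.mem_sup_right
      (neg_mem (G.lie_H_nPos (hT ht) (G.e_mem_nPos hi))))
  · exact Submodule.mem_sup_left (Submodule.mem_sup_right
      ((G.nPos K).lie_mem (G.e_mem_nPos hi) hp))
  · have := G.op.lie_f_nPos hT (fun j hj => by simpa using hc j hj) i hn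
    have hle : T ⊔ (G.op.nPos K).toSubmodule ≤ G.tri T K := sup_le_sup_right le_sup_left _
    exact hle this

lemma op_tri (T : Submodule ℂ g) (K : Set I) : G.op.tri T K = G.tri T K := by
  rw [tri, tri, sup_assoc, sup_assoc, sup_comm (a := (G.nPos K).toSubmodule)]
  rfl

lemma lie_f_tri {T : Submodule ℂ g} {K : Set I} (hT : T ≤ G.H)
    (hc : ∀ i ∈ K, (G.coroot i : g) ∈ T) {i : I} (hi : i ∈ K) {x : g} (hx : x ∈ G.tri T K) :
    ⁅G.f i, x⁆ ∈ G.tri T K := by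
  rw [← op_tri] at hx ⊢
  exact G.op.lie_e_tri hT (fun i hi => by simpa using hc i hi) hi hx

lemma lie_H_tri {T : Submodule ℂ g} {K : Set I} (hT : T ≤ G.H) {h : g} (hh : h ∈ G.H) {x : g}
    (hx : x ∈ G.tri T K) : ⁅h, x⁆ ∈ G.tri T K := by
  obtain ⟨y, hy, n, hn, rfl⟩ := Submodule.mem_sup.mp hx
  obtain ⟨t, ht, p, hp, rfl⟩ := Submodule.mem_sup.mp hy
  rw [lie_add, lie_add, G.abelian ⟨h, hh⟩ ⟨t, hT ht⟩, zero_add]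
  exact add_mem (Submodule.mem_sup_left (Submodule.mem_sup_right (G.lie_H_nPos hh hp)))
    (Submodule.mem_sup_right (G.op.lie_H_nPos hh hn))

lemma lieSpan_le_tri {T : Submodule ℂ g} {K : Set I} (hT : T ≤ G.H)
    (hc : ∀ i ∈ K, (G.coroot i : g) ∈ T) :
    (LieSubalgebra.lieSpan ℂ g
      ((T : Set g) ∪ {x | ∃ i ∈ K, x = G.e i} ∪ {x | ∃ i ∈ K, x = G.f i})).toSubmodule ≤
      G.tri T K := by
  have stab : ∀ x ∈ LieSubalgebra.lieSpan ℂ g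
      ((T : Set g) ∪ {x | ∃ i ∈ K, x = G.e i} ∪ {x | ∃ i ∈ K, x = G.f i}),
      ∀ y ∈ G.tri T K, ⁅x, y⁆ ∈ G.tri T K := by
    intro x hx
    induction hx using LieSubalgebra.lieSpan_induction with
    | mem z hz =>
      intro y hy
      rcases hz with (hz | ⟨i, hi, rfl⟩) | ⟨i, hi, rfl⟩
      · exact G.lie_H_tri hT (hT hz) hy
      · exact G.lie_e_tri hT hc hi hy
      · exact G.lie_f_tri hT hc hi hy
    | zero => intro y _; simp
    | add _ _ _ _ hu hv => intro y hy; rw [add_lie]; exact add_mem (hu y hy) (hv y hy)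
    | smul t _ _ hu => intro y hy; rw [smul_lie]; exact Submodule.smul_mem _ t (hu y hy)
    | lie a b _ _ hu hv =>
      intro y hy
      rw [lie_lie]
      exact sub_mem (hu _ (hv y hy)) (hv _ (hu y hy))
  intro x hx
  induction hx using LieSubalgebra.lieSpan_induction with
  | mem z hz =>
    rcases hz with (hz | ⟨i, hi, rfl⟩) | ⟨i, hi, rfl⟩
    · exact Submodule.mem_sup_left (Submodule.mem_sup_left hz)
    · exact Submodule.mem_sup_left (Submodule.mem_sup_right (G.e_mem_nPos hi))
    · exact Submodule.mem_sup_right (G.op.e_mem_nPos hi)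
  | zero => exact zero_mem _
  | add _ _ _ _ hu hv => exact add_mem hu hv
  | smul t _ _ hu => exact Submodule.smul_mem _ t hu
  | lie x y hx _ _ hv => exact stab x hx y hv

lemma top_le_tri : ⊤ ≤ G.tri G.H Set.univ := by
  refine le_trans ?_ (G.lieSpan_le_tri le_rfl (K := Set.univ) fun i _ => (G.coroot i).2)
  intro x _
  have hx : x ∈ LieSubalgebra.lieSpan ℂ g ((G.H : Set g) ∪ Set.range G.e ∪ Set.range G.f) := by
    rw [G.generates]; exact LieSubalgebra.mem_top x
  refine LieSubalgebra.lieSpan_mono ?_ hx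
  refine Set.union_subset_union (Set.union_subset_union le_rfl ?_) ?_
  all_goals
    rintro _ ⟨i, rfl⟩
    exact ⟨i, trivial, rfl⟩

/-- The span of the coroots indexed by `K`, as a subspace of `g`. -/
def corootSpan (K : Set I) : Submodule ℂ g :=
  (Submodule.span ℂ (G.coroot '' K)).map G.H.subtype

lemma corootSpan_le_H (K : Set I) : G.corootSpan K ≤ G.H := by
  rintro _ ⟨x, -, rfl⟩
  exact x.2

lemma coroot_mem_corootSpan {K : Set I} {i : I} (hi : i ∈ K) :
    (G.coroot i : g) ∈ G.corootSpan K :=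
  Submodule.mem_map_of_mem (f := G.H.subtype) (Submodule.subset_span ⟨i, hi, rfl⟩)

lemma gS_le_tri (K : Set I) : (gS G K).toSubmodule ≤ G.tri (G.corootSpan K) K :=
  le_trans (LieSubalgebra.lieSpan_mono
    (Set.union_subset_union_left _ Set.subset_union_right))
    (G.lieSpan_le_tri (G.corootSpan_le_H K) fun _ hi => G.coroot_mem_corootSpan hi)

lemma nPos_le_gS (K : Set I) : G.nPos K ≤ gS G K :=
  LieSubalgebra.lieSpan_mono Set.subset_union_left

lemma op_gS (K : Set I) : gS G.op K = gS G K := by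
  rw [gS, gS, Set.union_comm]

lemma zero_notMem_cone (K : Set I) : (0 : Dual ℂ G.H) ∉ G.cone K := by
  rintro ⟨c, -, h0, -, h⟩
  exact h0 (G.lat_injective (h.symm.trans G.lat_zero.symm))

lemma disjoint_cone_op (K L : Set I) : Disjoint (G.cone K) (G.op.cone L) := by
  rw [Set.disjoint_left]
  rintro _ ⟨c, hc, h0, -, rfl⟩ ⟨d, hd, -, -, h⟩
  rw [op_lat, ← lat_neg] at h
  have := G.lat_injective h
  exact h0 (le_antisymm (this ▸ neg_nonpos.mpr hd) hc)

lemma disjoint_cone {K L : Set I} (h : Disjoint K L) : Disjoint (G.cone K) (G.cone L) := by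
  rw [Set.disjoint_left]
  rintro _ ⟨c, -, h0, hcK, rfl⟩ ⟨d, -, -, hdL, h'⟩
  have := G.lat_injective h'
  subst this
  refine h0 (funext fun i => ?_)
  by_cases hi : i ∈ K
  · exact hdL i (Set.disjoint_left.mp h hi)
  · exact hcK i hi

lemma H_le_wtSum : G.H ≤ wtSum G.H.subtype {0} := fun x hx =>
  wtSpaceι_le_wtSum (Set.mem_singleton _) ((G.mem_H_iff x).mp hx)

/-- The weights occurring in `g` are `0` or nonnegative or nonpositive combinations of the
simple roots. -/
lemma mem_of_ws_ne_bot {χ : Dual ℂ G.H} (h : G.ws χ ≠ ⊥) :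
    χ = 0 ∨ χ ∈ G.cone Set.univ ∨ χ ∈ G.op.cone Set.univ := by
  by_contra! hn
  refine h (eq_bot_iff.mpr fun x hx => ?_)
  have htop : (⊤ : Submodule ℂ g) ≤
      wtSum G.H.subtype ({0} ∪ G.cone Set.univ ∪ G.op.cone Set.univ) := by
    refine G.top_le_tri.trans (sup_le (sup_le ?_ ?_) ?_)
    · exact G.H_le_wtSum.trans
        (wtSum_mono (Set.subset_union_left.trans Set.subset_union_left))
    · exact (G.nPos_le_wtSum _).trans
        (wtSum_mono (Set.subset_union_right.trans Set.subset_union_left))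
    · exact (G.op.nPos_le_wtSum _).trans (wtSum_mono Set.subset_union_right)
  refine eq_zero_of_mem_wtSum (P := {χ}) ?_ (wtSpaceι_le_wtSum (Set.mem_singleton χ) hx)
    (htop Submodule.mem_top)
  rw [Set.disjoint_singleton_left]
  simpa [not_or, and_assoc] using hn

lemma nPos_univ_le (T : Set I) : (G.nPos Set.univ).toSubmodule ≤
    (G.nPos T).toSubmodule ⊔ wtSum G.H.subtype (G.cone Set.univ \ G.cone T) := by
  set R := wtSum G.H.subtype (G.cone Set.univ \ G.cone T) with hR
  have absorb : ∀ χ ∈ G.cone Set.univ \ G.cone T, ∀ ψ ∈ G.cone Set.univ,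
      χ + ψ ∈ G.cone Set.univ \ G.cone T := by
    rintro χ ⟨hχ, hχT⟩ ψ hψ
    refine ⟨G.cone_add hχ hψ, ?_⟩
    obtain ⟨c, hc, hc0, -, rfl⟩ := hχ
    obtain ⟨d, hd, -, -, rfl⟩ := hψ
    rintro ⟨a, -, -, haT, h⟩
    rw [← lat_add] at h
    have := G.lat_injective h
    refine hχT ⟨c, hc, hc0, fun i hi => ?_, rfl⟩
    have h1 := congrFun this i
    rw [haT i hi, Pi.add_apply] at h1
    have h2 := hc i
    have h3 := hd i
    simp only [Pi.zero_apply] at h2 h3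
    linarith
  have hRlie : ∀ x ∈ R, ∀ y ∈ wtSum G.H.subtype (G.cone Set.univ), ⁅x, y⁆ ∈ R :=
    fun x hx y hy => lie_mem_wtSum absorb hx hy
  have hle : (G.nPos T).toSubmodule ⊔ R ≤ wtSum G.H.subtype (G.cone Set.univ) :=
    sup_le ((G.nPos_le_wtSum T).trans (wtSum_mono (G.cone_mono (Set.subset_univ _))))
      (wtSum_mono Set.sdiff_subset)
  intro x hx
  induction hx using LieSubalgebra.lieSpan_induction with
  | mem y h =>
    obtain ⟨i, -, rfl⟩ := h
    by_cases hi : i ∈ T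
    · exact Submodule.mem_sup_left (G.e_mem_nPos hi)
    · suffices h : G.root i ∉ G.cone T from Submodule.mem_sup_right
        (wtSpaceι_le_wtSum (Set.mem_sdiff_of_mem (G.root_mem_cone (Set.mem_univ i)) h)
          (G.e_mem_ws i))
      rintro ⟨a, -, -, haT, h⟩
      rw [← lat_single] at h
      have := congrFun (G.lat_injective h) i
      rw [haT i hi] at this
      simp at this
  | zero => exact zero_mem _
  | add _ _ _ _ hu hv => exact add_mem hu hv
  | smul t _ _ hu => exact Submodule.smul_mem _ t hu
  | lie x y _ _ hu hv =>
    have hy := hle hv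
    obtain ⟨a, ha, b, hb, rfl⟩ := Submodule.mem_sup.mp hu
    rw [add_lie]
    refine add_mem ?_ (Submodule.mem_sup_right (hRlie b hb y hy))
    obtain ⟨a', ha', b', hb', rfl⟩ := Submodule.mem_sup.mp hv
    rw [lie_add]
    refine add_mem (Submodule.mem_sup_left ((G.nPos T).lie_mem ha ha')) ?_
    rw [← lie_skew]
    exact neg_mem (Submodule.mem_sup_right
      (hRlie b' hb' a (hle (Submodule.mem_sup_left ha))))

/-- The weight spaces with weights in the cone spanned by the simple roots indexed by `T` lie in
the subalgebra generated by the corresponding `e i`. -/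
lemma wtSum_cone_le (T : Set I) :
    wtSum G.H.subtype (G.cone T) ≤ (G.nPos T).toSubmodule := by
  refine wtSum_le_of_top_le (G.nPos_le_wtSum T)
    (Q := {0} ∪ (G.cone Set.univ \ G.cone T) ∪ G.op.cone Set.univ) ?_ ?_
  · rw [Set.disjoint_union_right, Set.disjoint_union_right]
    refine ⟨⟨?_, ?_⟩, G.disjoint_cone_op _ _⟩
    · exact Set.disjoint_singleton_right.mpr (G.zero_notMem_cone T)
    · exact Set.disjoint_sdiff_right
  · refine G.top_le_tri.trans (sup_le (sup_le ?_ ?_) ?_)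
    · exact G.H_le_wtSum.trans (le_sup_of_le_right
        (wtSum_mono (Set.subset_union_left.trans Set.subset_union_left)))
    · refine (G.nPos_univ_le T).trans (sup_le_sup_left (wtSum_mono
        (Set.subset_union_right.trans Set.subset_union_left)) _)
    · exact (G.op.nPos_le_wtSum _).trans
        (le_sup_of_le_right (wtSum_mono Set.subset_union_right))

end KacMoodyAlgebra

end Structure

section TriangularStructure

variable {I : Type*} [Fintype I] [DecidableEq I] {A : Matrix I I ℤ}
variable {g : Type*} [LieRing g] [LieAlgebra ℂ g]

lemma lie_lieSpan_lieSpan_eq_zero {s t : Set g} (h : ∀ x ∈ s, ∀ y ∈ t, ⁅x, y⁆ = 0) {x y : g}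
    (hx : x ∈ LieSubalgebra.lieSpan ℂ g s) (hy : y ∈ LieSubalgebra.lieSpan ℂ g t) :
    ⁅x, y⁆ = 0 := by
  induction hx using LieSubalgebra.lieSpan_induction with
  | mem x hx =>
    induction hy using LieSubalgebra.lieSpan_induction with
    | mem y hy => exact h x hx y hy
    | zero => simp
    | add _ _ _ _ hu hv => rw [lie_add, hu, hv, add_zero]
    | smul t _ _ hu => rw [lie_smul, hu, smul_zero]
    | lie _ _ _ _ hu hv => rw [leibniz_lie, hu, hv, zero_lie, lie_zero, add_zero]
  | zero => simp
  | add _ _ _ _ hu hv => rw [add_lie, hu, hv, add_zero]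
  | smul t _ _ hu => rw [smul_lie, hu, smul_zero]
  | lie _ _ _ _ hu hv => rw [lie_lie, hu, hv, lie_zero, lie_zero, sub_zero]

lemma ad_pow_mem_wtSpaceι {V : Type*} [AddCommGroup V] [Module ℂ V] {ι : V →ₗ[ℂ] g}
    {χ ψ : Dual ℂ V} {a x : g} (ha : a ∈ wtSpaceι ι ψ) (hx : x ∈ wtSpaceι ι χ) (k : ℕ) :
    ((LieAlgebra.ad ℂ g a) ^ k) x ∈ wtSpaceι ι (χ + (k : ℂ) • ψ) := by
  induction k with
  | zero => simpa using hx
  | succ k ih =>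
    rw [pow_succ', Module.End.mul_apply, LieAlgebra.ad_apply]
    have := lie_mem_wtSpaceι ha ih
    convert this using 2
    push_cast
    rw [add_smul, one_smul]
    abel

namespace KacMoodyAlgebra

variable (G : KacMoodyAlgebra A g)

lemma root_coroot_self {i : I} (hA : A i i = 2) : G.root i (G.coroot i) = 2 := by
  rw [G.pairing, hA]; norm_num

lemma mem_engel_e {i : I} (hA : A i i = 2) (x : g) :
    ∃ n : ℕ, ((LieAlgebra.ad ℂ g (G.e i)) ^ n) x = 0 := by
  rw [← LieSubalgebra.mem_engel_iff]
  have hH : ∀ h ∈ G.H, ⁅G.e i, ⁅G.e i, h⁆⁆ = 0 := by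
    intro h hh
    rw [← lie_skew (G.e i) h, G.lie_e ⟨h, hh⟩ i, lie_neg, lie_smul, lie_self, smul_zero, neg_zero]
  have hle : LieSubalgebra.lieSpan ℂ g ((G.H : Set g) ∪ Set.range G.e ∪ Set.range G.f) ≤
      LieSubalgebra.engel ℂ (G.e i) := by
    rw [LieSubalgebra.lieSpan_le]
    rintro y ((hy | ⟨j, rfl⟩) | ⟨j, rfl⟩)
    · refine (LieSubalgebra.mem_engel_iff _ _ _).mpr ⟨2, ?_⟩
      simpa [pow_two] using hH y hy
    · by_cases hij : i = j
      · subst hij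
        exact LieSubalgebra.self_mem_engel _ _
      · exact (LieSubalgebra.mem_engel_iff _ _ _).mpr ⟨_, G.serre_e i j hij⟩
    · by_cases hij : j = i
      · refine (LieSubalgebra.mem_engel_iff _ _ _).mpr ⟨3, ?_⟩
        subst hij
        simpa [pow_succ, G.e_f] using hH _ (G.coroot j).2
      · refine (LieSubalgebra.mem_engel_iff _ _ _).mpr ⟨1, ?_⟩
        simp [G.e_f, hij]
  rw [G.generates] at hle
  exact hle (LieSubalgebra.mem_top x)

lemma isSl2Triple {i : I} (hA : A i i = 2) :
    IsSl2Triple (G.coroot i : g) (G.e i) (G.f i) where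
  h_ne_zero h := by
    have h0 : G.coroot i = 0 := Subtype.ext h
    have := G.root_coroot_self hA
    rw [h0, map_zero] at this
    norm_num at this
  lie_e_f := by simp [G.e_f]
  lie_h_e_nsmul := by
    rw [G.lie_e, G.root_coroot_self hA, ← Nat.cast_smul_eq_nsmul ℂ]; norm_num
  lie_h_f_nsmul := by
    rw [G.lie_f, G.root_coroot_self hA, ← Nat.cast_smul_eq_nsmul ℂ]; simp

lemma ws_reflect_of_nonneg {i : I} (hA : A i i = 2) {c : I → ℤ} (hc : G.ws (G.lat c) ≠ ⊥)
    (hn : 0 ≤ ∑ j, A i j * c j) :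
    G.ws (G.lat (c - (∑ j, A i j * c j) • Pi.single i 1)) ≠ ⊥ := by
  obtain ⟨n, hn'⟩ := Int.eq_ofNat_of_zero_le hn
  obtain ⟨x, hx, hx0⟩ := Submodule.exists_mem_ne_zero_of_ne_bot hc
  obtain ⟨q, hq, hq'⟩ : ∃ q : ℕ, ((LieAlgebra.ad ℂ g (G.e i)) ^ q) x ≠ 0 ∧
      ((LieAlgebra.ad ℂ g (G.e i)) ^ (q + 1)) x = 0 :=
    Nat.exists_not_and_succ_of_not_zero_of_exists (by simpa using hx0) (G.mem_engel_e hA x)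
  set y := ((LieAlgebra.ad ℂ g (G.e i)) ^ q) x with hy
  have hyw : y ∈ G.ws (G.lat c + (q : ℂ) • G.root i) := ad_pow_mem_wtSpaceι (G.e_mem_ws i) hx q
  have P : (G.isSl2Triple hA).HasPrimitiveVectorWith y (((n + 2 * q : ℕ) : ℂ)) :=
    { ne_zero := hq
      lie_h := by
        have := hyw (G.coroot i)
        rw [Submodule.subtype_apply] at this
        rw [this, LinearMap.add_apply, LinearMap.smul_apply, G.root_coroot_self hA,
          G.lat_apply_coroot, hn']
        push_cast
        rw [smul_eq_mul, mul_comm (q : ℂ)]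
      lie_e := by
        rw [pow_succ', Module.End.mul_apply, LieAlgebra.ad_apply] at hq'
        exact hq' }
  have hz := P.pow_toEnd_f_ne_zero_of_eq_nat rfl (i := n + q) (by lia)
  have hzw := ad_pow_mem_wtSpaceι (G.f_mem_ws i) hyw (n + q)
  refine (Submodule.ne_bot_iff _).mpr ⟨_, ?_, hz⟩
  have heq : G.lat (c - (∑ j, A i j * c j) • Pi.single i 1) =
      G.lat c + (q : ℂ) • G.root i + ((n + q : ℕ) : ℂ) • -G.root i := by
    rw [lat_sub, lat_smul, lat_single, hn']
    push_cast
    module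
  rw [ws, heq]
  exact hzw

/-- The set of weights is stable under the simple reflections. -/
lemma ws_reflect {i : I} (hA : A i i = 2) {c : I → ℤ} (hc : G.ws (G.lat c) ≠ ⊥) :
    G.ws (G.lat (c - (∑ j, A i j * c j) • Pi.single i 1)) ≠ ⊥ := by
  rcases le_total 0 (∑ j, A i j * c j) with hn | hn
  · exact G.ws_reflect_of_nonneg hA hc hn
  · have hneg : ∑ j, A i j * (-c) j = -∑ j, A i j * c j := by simp
    have h1 : G.op.lat (-c) = G.lat c := by rw [op_lat, lat_neg, neg_neg]
    have := G.op.ws_reflect_of_nonneg hA (c := -c) (by rw [h1]; exact hc) (by rw [hneg]; lia)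
    rw [op_lat, ← lat_neg, hneg] at this
    have h2 : -(-c - (-(∑ j, A i j * c j)) • Pi.single i 1) =
        c - (∑ j, A i j * c j) • (Pi.single i 1 : I → ℤ) := by module
    rw [h2] at this
    exact this

lemma gS_lie_gS_eq_zero {C D : Set I} (hdisj : Disjoint C D) (hCD : ∀ i ∈ C, ∀ j ∈ D, A i j = 0)
    {x y : g} (hx : x ∈ gS G C) (hy : y ∈ gS G D) : ⁅x, y⁆ = 0 := by
  refine lie_lieSpan_lieSpan_eq_zero ?_ hx hy
  have hne : ∀ i ∈ C, ∀ j ∈ D, i ≠ j := fun i hi j hj h =>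
    Set.disjoint_left.mp hdisj hi (h ▸ hj)
  rintro _ (⟨i, hi, rfl⟩ | ⟨i, hi, rfl⟩) _ (⟨j, hj, rfl⟩ | ⟨j, hj, rfl⟩)
  · simpa [hCD i hi j hj] using G.serre_e i j (hne i hi j hj)
  · rw [G.e_f, if_neg (hne i hi j hj).symm]
  · rw [← lie_skew, G.e_f, if_neg (hne i hi j hj), neg_zero]
  · simpa [hCD i hi j hj] using G.serre_f i j (hne i hi j hj)

lemma nPos_union_le {C D : Set I} (hdisj : Disjoint C D) (hCD : ∀ i ∈ C, ∀ j ∈ D, A i j = 0) :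
    (G.nPos (C ∪ D)).toSubmodule ≤ (G.nPos C).toSubmodule ⊔ (G.nPos D).toSubmodule := by
  have hcomm : ∀ x ∈ G.nPos C, ∀ y ∈ G.nPos D, ⁅x, y⁆ = 0 := fun x hx y hy =>
    G.gS_lie_gS_eq_zero hdisj hCD (G.nPos_le_gS C hx) (G.nPos_le_gS D hy)
  intro x hx
  induction hx using LieSubalgebra.lieSpan_induction with
  | mem y h =>
    obtain ⟨i, hi | hi, rfl⟩ := h
    · exact Submodule.mem_sup_left (G.e_mem_nPos hi)
    · exact Submodule.mem_sup_right (G.e_mem_nPos hi)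
  | zero => exact zero_mem _
  | add _ _ _ _ hu hv => exact add_mem hu hv
  | smul t _ _ hu => exact Submodule.smul_mem _ t hu
  | lie x y _ _ hu hv =>
    obtain ⟨a, ha, b, hb, rfl⟩ := Submodule.mem_sup.mp hu
    obtain ⟨a', ha', b', hb', rfl⟩ := Submodule.mem_sup.mp hv
    have h1 : ⁅b, a'⁆ = 0 := by rw [← lie_skew, hcomm a' ha' b hb, neg_zero]
    rw [add_lie, lie_add, lie_add, hcomm a ha b' hb', h1, add_zero, zero_add]
    exact Submodule.add_mem_sup ((G.nPos C).lie_mem ha ha') ((G.nPos D).lie_mem hb hb')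

/-- A connected component of a subdiagram supports a root. -/
lemma exists_ws_ne_bot_of_cmpnt (hGCM : IsGCM A) {K : Set I} {k : I} (hk : k ∈ K) :
    ∃ c : I → ℤ, 0 ≤ c ∧ (∀ i, c i ≠ 0 ↔ i ∈ cmpnt A K k) ∧ G.ws (G.lat c) ≠ ⊥ := by
  have hmax : ∃ s : Finset I, Maximal (fun s : Finset I => k ∈ s ∧ ∃ c : I → ℤ, 0 ≤ c ∧
      (∀ i, c i ≠ 0 ↔ i ∈ s) ∧ (∀ i ∈ s, i ∈ cmpnt A K k) ∧ G.ws (G.lat c) ≠ ⊥) s := by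
    refine (Set.toFinite _).exists_maximal (s := {s | _})
      ⟨{k}, by simp, Pi.single k 1, ?_, ?_, ?_, ?_⟩
    · intro j; by_cases h : j = k <;> simp [h]
    · intro j; by_cases h : j = k <;> simp [h]
    · simpa [cmpnt] using ⟨hk, Relation.ReflTransGen.refl⟩
    · rw [lat_single]
      exact (Submodule.ne_bot_iff _).mpr ⟨_, G.e_mem_ws k, (G.isSl2Triple (hGCM.1 k)).e_ne_zero⟩
  obtain ⟨s, ⟨hks, c, hc, hcs, hsK, hw⟩, hs⟩ := hmax
  refine ⟨c, hc, fun i => (hcs i).trans ⟨hsK i, fun hi => ?_⟩, hw⟩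
  have step : ∀ i j, i ∈ s → j ∈ K → A i j ≠ 0 → j ∈ s := by
    intro i j hi hj hij
    by_contra hjs
    have hcj : c j = 0 := by by_contra h; exact hjs ((hcs j).mp h)
    have hneg : ∑ l, A j l * c l < 0 := by
      refine Finset.sum_neg' (fun l _ => ?_) ⟨i, Finset.mem_univ i, ?_⟩
      · by_cases hl : l = j
        · simp [hl, hcj]
        · exact mul_nonpos_of_nonpos_of_nonneg (hGCM.2.1 j l (Ne.symm hl)) (hc l)
      · have h1 : A j i ≠ 0 := fun h => hij (hGCM.2.2 j i h)
        have h2 : j ≠ i := fun h => hjs (h ▸ hi)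
        exact mul_neg_of_neg_of_pos (lt_of_le_of_ne (hGCM.2.1 j i h2) h1)
          (lt_of_le_of_ne (hc i) (Ne.symm ((hcs i).mpr hi)))
    have key := hs (y := insert j s) ⟨Finset.mem_insert_of_mem hks,
      c - (∑ l, A j l * c l) • Pi.single j 1, ?_, ?_, ?_, G.ws_reflect (hGCM.1 j) hw⟩
      (Finset.subset_insert j s)
    · exact hjs (key (Finset.mem_insert_self j s))
    · intro l
      by_cases hl : l = j
      · subst hl; simp [hcj]; lia
      · simpa [hl] using hc l
    · intro l
      by_cases hl : l = j
      · subst hl; simp [hcj, hneg.ne]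
      · simpa [hl] using hcs l
    · intro l hl
      rcases Finset.mem_insert.mp hl with rfl | hl
      · exact ⟨hj, (hsK i hi).2.tail ⟨(hsK i hi).1, hj, hij⟩⟩
      · exact hsK l hl
  obtain ⟨-, hi⟩ := hi
  induction hi with
  | refl => exact hks
  | tail _ h ih => exact step _ _ ih h.2.1 h.2.2

end KacMoodyAlgebra

end TriangularStructure

section Components

variable {I : Type*} {A : Matrix I I ℤ}

lemma cmpnt_subset {T : Set I} {k : I} : cmpnt A T k ⊆ T := fun _ h => h.1

lemma self_mem_cmpnt {T : Set I} {k : I} (hk : k ∈ T) : k ∈ cmpnt A T k :=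
  ⟨hk, Relation.ReflTransGen.refl⟩

lemma mem_cmpnt_of_adj {T : Set I} {k i j : I} (hi : i ∈ cmpnt A T k) (hj : j ∈ T)
    (hij : A i j ≠ 0) : j ∈ cmpnt A T k := ⟨hj, hi.2.tail ⟨hi.1, hj, hij⟩⟩

lemma reflTransGen_cmpnt {T : Set I} {k i : I} (hi : i ∈ cmpnt A T k) :
    Relation.ReflTransGen (fun x y => x ∈ cmpnt A T k ∧ y ∈ cmpnt A T k ∧ A x y ≠ 0) k i := by
  obtain ⟨-, h⟩ := hi
  induction h with
  | refl => exact .refl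
  | tail h1 h2 ih => exact ih.tail ⟨⟨h2.1, h1⟩, ⟨h2.2.1, h1.tail h2⟩, h2.2.2⟩

lemma reflTransGen_symm (hGCM : IsGCM A) {T : Set I} {i j : I}
    (h : Relation.ReflTransGen (fun x y => x ∈ T ∧ y ∈ T ∧ A x y ≠ 0) i j) :
    Relation.ReflTransGen (fun x y => x ∈ T ∧ y ∈ T ∧ A x y ≠ 0) j i := by
  have : Std.Symm (fun x y => x ∈ T ∧ y ∈ T ∧ A x y ≠ 0) :=
    ⟨fun x y ⟨h1, h2, h3⟩ => ⟨h2, h1, fun h => h3 (hGCM.2.2 _ _ h)⟩⟩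
  exact Relation.ReflTransGen.stdSymm.symm _ _ h

lemma cmpnt_eq_of_mem (hGCM : IsGCM A) {T : Set I} {i k : I} (hi : i ∈ cmpnt A T k) :
    cmpnt A T i = cmpnt A T k := by
  ext j
  exact ⟨fun hj => ⟨hj.1, hi.2.trans hj.2⟩,
    fun hj => ⟨hj.1, (reflTransGen_symm hGCM hi.2).trans hj.2⟩⟩

lemma exists_step {α : Type*} {r : α → α → Prop} {P : α → Prop} {a b : α}
    (h : Relation.ReflTransGen r a b) (ha : P a) (hb : ¬P b) : ∃ x y, r x y ∧ P x ∧ ¬P y := by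
  by_contra! H
  refine hb ?_
  induction h with
  | refl => exact ha
  | tail h1 h2 ih =>
    exact H _ _ h2 (by_contra fun h => absurd (ih h) h)

lemma exists_pos_symmetrizer (hGCM : IsGCM A) (hSym : Symmetrizable A) :
    ∃ d : I → ℚ, (∀ i, 0 < d i) ∧ ∀ i j, d i * (A i j : ℚ) = d j * (A j i : ℚ) := by
  obtain ⟨d, hd, h⟩ := hSym
  refine ⟨fun i => |d i|, fun i => abs_pos.mpr (hd i), fun i j => ?_⟩
  by_cases hij : i = j
  · rw [hij]
  · have h1 : (A i j : ℚ) ≤ 0 := by exact_mod_cast hGCM.2.1 i j hij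
    have h2 : (A j i : ℚ) ≤ 0 := by exact_mod_cast hGCM.2.1 j i (Ne.symm hij)
    have := congrArg abs (h i j)
    rw [abs_mul, abs_mul, abs_of_nonpos h1, abs_of_nonpos h2] at this
    linarith

end Components

section Matrices

variable {I : Type*} [Fintype I] {A : Matrix I I ℤ}

/-- `u` is positive on `K`, vanishes outside `K`, and the coordinates of `A u` in `K`
satisfy `R`. -/
def SolOn (R : ℚ → Prop) (A : Matrix I I ℤ) (K : Set I) (u : I → ℚ) : Prop :=
  (∀ i ∈ K, 0 < u i) ∧ (∀ i ∉ K, u i = 0) ∧ ∀ i ∈ K, R (∑ j, (A i j : ℚ) * u j)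

lemma finsum_coe_eq_sum {K : Set I} {f : I → ℚ} (h : ∀ i ∉ K, f i = 0) :
    ∑ᶠ j : K, f j = ∑ j, f j := by
  rw [finsum_set_coe_eq_finsum_mem, finsum_mem_def, Set.indicator_eq_self.mpr,
    finsum_eq_sum_of_fintype]
  intro i hi
  by_contra h'
  exact hi (h i h')

lemma exists_solOn_iff {R : ℚ → Prop} {K : Set I} :
    (∃ u : K → ℚ, (∀ i, 0 < u i) ∧ ∀ i, R (∑ᶠ j, (restrictM A K i j : ℚ) * u j)) ↔
      ∃ u, SolOn R A K u := by
  constructor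
  · rintro ⟨u, hu, hR⟩
    refine ⟨fun i => if h : i ∈ K then u ⟨i, h⟩ else 0, fun i hi => by simp [hi, hu],
      fun i hi => by simp [hi], fun i hi => ?_⟩
    rw [← finsum_coe_eq_sum (K := K) (fun j hj => by simp [hj])]
    simpa [restrictM] using hR ⟨i, hi⟩
  · rintro ⟨u, hu, hu0, hR⟩
    refine ⟨fun i => u i, fun i => hu i i.2, fun i => ?_⟩
    have := hR i i.2
    rw [← finsum_coe_eq_sum (K := K) (fun j hj => by simp [hu0 j hj])] at this
    exact this

lemma isFiniteType_restrictM_iff {K : Set I} :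
    IsFiniteType (restrictM A K) ↔ ∃ u, SolOn (0 < ·) A K u := exists_solOn_iff

lemma sum_le_sum_indicator (hGCM : IsGCM A) {K T : Set I} {u : I → ℚ}
    (hu : ∀ i, 0 ≤ u i) (hu0 : ∀ i ∉ T, u i = 0) {i : I} (hi : i ∈ K ∪ Tᶜ) :
    ∑ j, (A i j : ℚ) * u j ≤ ∑ j, (A i j : ℚ) * K.indicator u j := by
  refine Finset.sum_le_sum fun j _ => ?_
  by_cases hj : j ∈ K
  · simp [hj]
  · by_cases hij : i = j
    · subst hij
      rcases hi with hi | hi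
      · exact absurd hi hj
      · simp [hj, hu0 i hi]
    · have : (A i j : ℚ) ≤ 0 := by exact_mod_cast hGCM.2.1 i j hij
      simpa [hj] using mul_nonpos_of_nonpos_of_nonneg this (hu j)

lemma SolOn.nonneg {R : ℚ → Prop} {K : Set I} {u : I → ℚ} (h : SolOn R A K u) (i : I) :
    0 ≤ u i := by
  by_cases hi : i ∈ K
  · exact (h.1 i hi).le
  · exact (h.2.1 i hi).ge

lemma SolOn.subset (hGCM : IsGCM A) {R : ℚ → Prop} (hR : ∀ p q, p ≤ q → R p → R q)
    {K T : Set I} (hKT : K ⊆ T) {u : I → ℚ} (h : SolOn R A T u) :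
    SolOn R A K (K.indicator u) := by
  refine ⟨fun i hi => by simpa [hi] using h.1 i (hKT hi), fun i hi => by simp [hi],
    fun i hi => hR _ _ ?_ (h.2.2 i (hKT hi))⟩
  exact sum_le_sum_indicator hGCM h.nonneg h.2.1 (Or.inl hi)

lemma isFiniteType_restrictM_mono (hGCM : IsGCM A) {K T : Set I} (hKT : K ⊆ T)
    (h : IsFiniteType (restrictM A T)) : IsFiniteType (restrictM A K) := by
  rw [isFiniteType_restrictM_iff] at h ⊢
  obtain ⟨u, hu⟩ := h
  exact ⟨_, hu.subset hGCM (fun p q hpq hp => lt_of_lt_of_le hp hpq) hKT⟩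

/-- Solutions on the connected components of `T` can be glued together. -/
lemma exists_solOn_of_cmpnt (hGCM : IsGCM A) {R : ℚ → Prop} {T : Set I}
    (h : ∀ k ∈ T, ∃ u, SolOn R A (cmpnt A T k) u) : ∃ u, SolOn R A T u := by
  have h' : ∀ C : Set I, ∃ u, (∃ k ∈ T, cmpnt A T k = C) → SolOn R A C u := by
    intro C
    by_cases hC : ∃ k ∈ T, cmpnt A T k = C
    · obtain ⟨k, hk, rfl⟩ := hC
      exact (h k hk).imp fun u hu _ => hu
    · exact ⟨0, fun h => absurd h hC⟩
  choose u hu using h'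
  refine ⟨fun i => if i ∈ T then u (cmpnt A T i) i else 0,
    fun i hi => by simpa [hi] using (hu _ ⟨i, hi, rfl⟩).1 i (self_mem_cmpnt hi),
    fun i hi => by simp [hi], fun i hi => ?_⟩
  convert (hu _ ⟨i, hi, rfl⟩).2.2 i (self_mem_cmpnt hi) using 1
  refine Finset.sum_congr rfl fun j _ => ?_
  beta_reduce
  by_cases hj : j ∈ cmpnt A T i
  · rw [if_pos hj.1, cmpnt_eq_of_mem hGCM hj]
  · rw [(hu _ ⟨i, hi, rfl⟩).2.1 j hj]
    split_ifs with hjT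
    · have : A i j = 0 := by
        by_contra h0
        exact hj (mem_cmpnt_of_adj (self_mem_cmpnt hi) hjT h0)
      simp [this]
    · rfl

/-- A nonnegative solution on a connected set which is not a null solution can be perturbed into a
positive one. -/
lemma exists_solOn_pos (hGCM : IsGCM A) {K : Set I} {u : I → ℚ} (h : SolOn (0 ≤ ·) A K u)
    {i₀ : I} (hpos : 0 < ∑ j, (A i₀ j : ℚ) * u j)
    (hconn : ∀ i ∈ K, Relation.ReflTransGen (fun x y => x ∈ K ∧ y ∈ K ∧ A x y ≠ 0) i₀ i) :
    ∃ u, SolOn (0 < ·) A K u := by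
  obtain ⟨n, hn⟩ : ∃ n, (Finset.univ.filter fun i => i ∈ K ∧ ∑ j, (A i j : ℚ) * u j = 0).card = n :=
    ⟨_, rfl⟩
  induction n using Nat.strong_induction_on generalizing u with
  | _ n ih =>
  by_cases hz : ∃ i ∈ K, ∑ j, (A i j : ℚ) * u j = 0
  swap
  · push Not at hz
    exact ⟨u, h.1, h.2.1, fun i hi => lt_of_le_of_ne (h.2.2 i hi) (hz i hi).symm⟩
  obtain ⟨z, hz, hz0⟩ := hz
  obtain ⟨x, y, ⟨hx, hy, hxy⟩, hpx, hpy⟩ :=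
    exists_step (P := fun i => 0 < ∑ j, (A i j : ℚ) * u j) (hconn z hz) hpos (by simp [hz0])
  have hy0 : ∑ j, (A y j : ℚ) * u j = 0 := le_antisymm (not_lt.mp hpy) (h.2.2 y hy)
  have hne : x ≠ y := fun h => hpy (h ▸ hpx)
  obtain ⟨ε, hε, hεm⟩ := exists_between (lt_min (h.1 x hx) (half_pos hpx))
  obtain ⟨hεu, hεx⟩ := lt_min_iff.mp hεm
  set v : I → ℚ := u - ε • Pi.single x 1 with hv
  have hsum : ∀ i, ∑ j, (A i j : ℚ) * v j = ∑ j, (A i j : ℚ) * u j - ε * A i x := by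
    intro i
    simp only [hv, Pi.sub_apply, Pi.smul_apply, smul_eq_mul, mul_sub, Finset.sum_sub_distrib]
    congr 1
    rw [Finset.sum_eq_single x] <;> simp +contextual [mul_comm]
  have hx2 : 0 < ∑ j, (A x j : ℚ) * v j := by
    rw [hsum, hGCM.1]; push_cast; linarith
  have hge : ∀ i, i ≠ x → ∑ j, (A i j : ℚ) * u j ≤ ∑ j, (A i j : ℚ) * v j := by
    intro i hi
    have : (A i x : ℚ) ≤ 0 := by exact_mod_cast hGCM.2.1 i x hi
    rw [hsum]; nlinarith
  have hy2 : 0 < ∑ j, (A y j : ℚ) * v j := by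
    have : (A y x : ℚ) < 0 := by
      exact_mod_cast lt_of_le_of_ne (hGCM.2.1 y x hne.symm) fun h => hxy (hGCM.2.2 _ _ h)
    rw [hsum, hy0]; nlinarith
  have hvS : SolOn (0 ≤ ·) A K v := by
    refine ⟨fun i hi => ?_, fun i hi => ?_, fun i hi => ?_⟩
    · by_cases hix : i = x
      · subst hix; simpa [hv] using hεu
      · simpa [hv, hix] using h.1 i hi
    · have hix : i ≠ x := fun h => hi (h ▸ hx)
      simpa [hv, hix] using h.2.1 i hi
    · by_cases hix : i = x
      · subst hix; exact hx2.le
      · exact (h.2.2 i hi).trans (hge i hix)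
  have hi₀v : 0 < ∑ j, (A i₀ j : ℚ) * v j := by
    by_cases hix : i₀ = x
    · rw [hix]; exact hx2
    · exact hpos.trans_le (hge _ hix)
  refine ih _ ?_ hvS hi₀v rfl
  rw [← hn]
  refine Finset.card_lt_card (Finset.ssubset_iff_of_subset ?_ |>.mpr ⟨y, ?_, ?_⟩)
  · intro i hi
    simp only [Finset.mem_filter, Finset.mem_univ, true_and] at hi ⊢
    refine ⟨hi.1, le_antisymm ?_ (h.2.2 i hi.1)⟩
    have hix : i ≠ x := by rintro rfl; exact hx2.ne' hi.2
    exact (hge i hix).trans hi.2.le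
  · simp [hy, hy0]
  · simp [hy2.ne']

/-- In finite type, `yᵀ A ≥ 0` implies `y ≥ 0`. -/
lemma nonneg_of_vecMul_nonneg (hGCM : IsGCM A) {T : Set I} (hT : IsFiniteType (restrictM A T))
    {y : I → ℝ} (hy : ∀ i ∉ T, y i = 0) (h : ∀ j ∈ T, 0 ≤ ∑ i, y i * A i j) (i : I) :
    0 ≤ y i := by
  obtain ⟨u, hu⟩ := isFiniteType_restrictM_iff.mp hT
  by_contra! hneg
  set N : Set I := {i | y i < 0} with hN
  have hNT : N ⊆ T := fun i hi => by
    by_contra hiT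
    exact absurd (hy i hiT) (ne_of_lt hi)
  have h1 : 0 ≤ ∑ j, (∑ i, y i * A i j) * (N.indicator u j : ℚ) := by
    refine Finset.sum_nonneg fun j _ => ?_
    by_cases hj : j ∈ N
    · exact mul_nonneg (h j (hNT hj)) (by simpa [hj] using hu.nonneg j)
    · simp [hj]
  have h2 : ∑ j, (∑ i, y i * A i j) * (N.indicator u j : ℚ) =
      ∑ i, y i * ((∑ j, (A i j : ℚ) * N.indicator u j : ℚ) : ℝ) := by
    push_cast
    simp only [Finset.sum_mul, Finset.mul_sum]
    rw [Finset.sum_comm]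
    simp only [mul_assoc]
  have h3 : ∑ i, y i * ((∑ j, (A i j : ℚ) * N.indicator u j : ℚ) : ℝ) < 0 := by
    have hlt : ∀ i ∈ N, y i * ((∑ j, (A i j : ℚ) * N.indicator u j : ℚ) : ℝ) < 0 := fun i hi =>
      mul_neg_of_neg_of_pos hi (by
        exact_mod_cast (hu.2.2 i (hNT hi)).trans_le
          (sum_le_sum_indicator hGCM hu.nonneg hu.2.1 (Or.inl hi)))
    refine Finset.sum_neg' (fun i _ => ?_) ⟨i, Finset.mem_univ i, hlt i hneg⟩
    by_cases hi : i ∈ N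
    · exact (hlt i hi).le
    · refine mul_nonpos_of_nonneg_of_nonpos (not_lt.mp hi) ?_
      have : ∑ j, (A i j : ℚ) * N.indicator u j ≤ 0 := by
        refine Finset.sum_nonpos fun j _ => ?_
        by_cases hj : j ∈ N
        · have hij : i ≠ j := fun h => hi (h ▸ hj)
          have : (A i j : ℚ) ≤ 0 := by exact_mod_cast hGCM.2.1 i j hij
          simpa [hj] using mul_nonpos_of_nonpos_of_nonneg this (hu.nonneg j)
        · simp [hj]
      exact_mod_cast this
  linarith

lemma eq_zero_of_vecMul_eq_zero (hGCM : IsGCM A) {T : Set I} (hT : IsFiniteType (restrictM A T))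
    {y : I → ℝ} (hy : ∀ i ∉ T, y i = 0) (h : ∀ j ∈ T, ∑ i, y i * A i j = 0) : y = 0 := by
  funext i
  refine le_antisymm ?_ (nonneg_of_vecMul_nonneg hGCM hT hy (fun j hj => (h j hj).ge) i)
  have := nonneg_of_vecMul_nonneg hGCM hT (y := -y) (by simpa using hy)
    (fun j hj => by simp [h j hj]) i
  simpa using this

/-- In finite, affine and hyperbolic type, deleting a vertex leaves a diagram with a positive
vector of nonnegative image. -/
lemma exists_solOn_compl (hGCM : IsGCM A)
    (htype : IsFiniteType A ∨ IsAffineType A ∨ IsHyperbolic A) (k : I) :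
    ∃ u, SolOn (0 ≤ ·) A {i | i ≠ k} u := by
  have key : (∃ u, SolOn (0 ≤ ·) A Set.univ u) → ∃ u, SolOn (0 ≤ ·) A {i | i ≠ k} u :=
    fun ⟨u, hu⟩ => ⟨_, hu.subset hGCM (fun p q hpq hp => le_trans hp hpq) (Set.subset_univ _)⟩
  rcases htype with ⟨u, hu, h⟩ | ⟨-, u, hu, h⟩ | h
  · refine key ⟨u, fun i _ => hu i, by simp, fun i _ => ?_⟩
    have := h i
    rw [finsum_eq_sum_of_fintype] at this
    exact this.le
  · refine key ⟨u, fun i _ => hu i, by simp, fun i _ => ?_⟩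
    have := h i
    rw [finsum_eq_sum_of_fintype] at this
    exact this.ge
  · refine exists_solOn_of_cmpnt hGCM fun l hl => exists_solOn_iff.mp ?_
    rcases h k l hl with ⟨u, hu, h⟩ | ⟨-, u, hu, h⟩
    · exact ⟨u, hu, fun i => (h i).le⟩
    · exact ⟨u, hu, fun i => (h i).ge⟩

end Matrices

section FiniteType

variable {I : Type*} [Fintype I] [DecidableEq I] {A : Matrix I I ℤ}
variable {g : Type*} [LieRing g] [LieAlgebra ℂ g]

namespace KacMoodyAlgebra

variable (G : KacMoodyAlgebra A g)

lemma ws_root_ne_bot (hGCM : IsGCM A) (i : I) : G.ws (G.root i) ≠ ⊥ :=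
  (Submodule.ne_bot_iff _).mpr ⟨_, G.e_mem_ws i, (G.isSl2Triple (hGCM.1 i)).e_ne_zero⟩

lemma nonneg_of_sum_pos {c : I → ℤ} (hc : G.ws (G.lat c) ≠ ⊥) (hpos : 0 < ∑ i, c i) : 0 ≤ c := by
  rcases G.mem_of_ws_ne_bot hc with h | ⟨d, hd, -, -, h⟩ | ⟨d, hd, -, -, h⟩
  · rw [← G.lat_zero] at h
    rw [G.lat_injective h]
  · rw [G.lat_injective h]
    exact hd
  · rw [op_lat, ← lat_neg] at h
    rw [G.lat_injective h] at hpos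
    have : ∑ i, (-d) i ≤ 0 := Finset.sum_nonpos fun i _ => by simpa using hd i
    lia

/-- A subdiagram supporting finitely many roots is of finite type. -/
theorem isFiniteType_of_finite (hGCM : IsGCM A) {T : Set I}
    (hfin : {c : I → ℤ | (∀ i ∉ T, c i = 0) ∧ G.ws (G.lat c) ≠ ⊥}.Finite) :
    IsFiniteType (restrictM A T) := by
  rw [isFiniteType_restrictM_iff]
  refine exists_solOn_of_cmpnt hGCM fun k hk => ?_
  have hkK : k ∈ cmpnt A T k := self_mem_cmpnt hk
  have hKT : cmpnt A T k ⊆ T := cmpnt_subset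
  have hconn : ∀ i ∈ cmpnt A T k, ∀ j ∈ cmpnt A T k, Relation.ReflTransGen
      (fun x y => x ∈ cmpnt A T k ∧ y ∈ cmpnt A T k ∧ A x y ≠ 0) i j := by
    intro i hi j hj
    have h := cmpnt_eq_of_mem hGCM hi
    rw [← h] at hj
    simpa only [h] using reflTransGen_cmpnt hj
  generalize cmpnt A T k = K at hkK hKT hconn ⊢
  set O : Set (I → ℤ) := {c | (∀ i ∉ K, c i = 0) ∧ G.ws (G.lat c) ≠ ⊥ ∧
    ∃ j ∈ K, ∑ l, A j l * c l ≠ 0} with hO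
  have hOfin : O.Finite := hfin.subset fun c hc => ⟨fun i hi => hc.1 i fun h => hi (hKT h), hc.2.1⟩
  have hk_mem : Pi.single k 1 ∈ O := by
    refine ⟨fun i hi => ?_, by rw [lat_single]; exact G.ws_root_ne_bot hGCM k, k, hkK, ?_⟩
    · have : i ≠ k := fun h => hi (h ▸ hkK)
      simp [this]
    · rw [Finset.sum_eq_single k] <;> simp +contextual [hGCM.1 k]
  obtain ⟨c, ⟨hcK, hcw, j, hjK, hj⟩, hmax⟩ :=
    Set.exists_max_image O (fun c => ∑ i, c i) hOfin ⟨_, hk_mem⟩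
  have hht : 0 < ∑ i, c i := by
    have := hmax _ hk_mem
    rw [Finset.sum_pi_single'] at this
    simp at this
    lia
  have hc0 : 0 ≤ c := G.nonneg_of_sum_pos hcw hht
  have hdom : ∀ i ∈ K, 0 ≤ ∑ l, A i l * c l := by
    intro i hi
    by_contra! hneg
    have hmem : c - (∑ l, A i l * c l) • Pi.single i 1 ∈ O := by
      refine ⟨fun l hl => ?_, G.ws_reflect (hGCM.1 i) hcw, i, hi, ?_⟩
      · have : l ≠ i := fun h => hl (h ▸ hi)
        simp [this, hcK l hl]
      · have hsum (n : ℤ) : ∑ l, A i l * (c - n • Pi.single i 1 : I → ℤ) l =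
            ∑ l, A i l * c l - n * 2 := by
          simp only [Pi.sub_apply, mul_sub, Finset.sum_sub_distrib, Pi.smul_apply, smul_eq_mul]
          congr 1
          rw [Finset.sum_eq_single i] <;> simp +contextual [hGCM.1 i, mul_comm]
        rw [hsum]
        lia
    have := hmax _ hmem
    simp only [Pi.sub_apply, Finset.sum_sub_distrib, Pi.smul_apply, ← Finset.smul_sum,
      Finset.sum_pi_single', Finset.mem_univ, if_true] at this
    simp at this
    lia
  have hsupp : ∀ i ∈ K, 0 < c i := by
    obtain ⟨i₁, -, hi₁⟩ : ∃ i ∈ Finset.univ, c i ≠ 0 := Finset.exists_ne_zero_of_sum_ne_zero hht.ne'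
    have hi₁K : i₁ ∈ K := by
      by_contra h
      exact hi₁ (hcK _ h)
    intro i hi
    by_contra hci
    obtain ⟨x, y, ⟨hx, hy, hxy⟩, hcx, hcy⟩ := exists_step (P := fun i => 0 < c i)
      (hconn i₁ hi₁K i hi) (lt_of_le_of_ne (hc0 i₁) hi₁.symm) hci
    have hcy0 : c y = 0 := le_antisymm (not_lt.mp hcy) (hc0 y)
    have hne : x ≠ y := fun h => hcy (h ▸ hcx)
    have : ∑ l, A y l * c l < 0 := by
      refine Finset.sum_neg' (fun l _ => ?_) ⟨x, Finset.mem_univ x, ?_⟩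
      · by_cases hl : y = l
        · simp [← hl, hcy0]
        · exact mul_nonpos_of_nonpos_of_nonneg (hGCM.2.1 y l hl) (hc0 l)
      · exact mul_neg_of_neg_of_pos (lt_of_le_of_ne (hGCM.2.1 y x hne.symm)
          fun h => hxy (hGCM.2.2 _ _ h)) hcx
    exact absurd (hdom y hy) (not_le.mpr this)
  have hcast : ∀ i, ∑ l, (A i l : ℚ) * (c l : ℚ) = ((∑ l, A i l * c l : ℤ) : ℚ) := by
    intro i; push_cast; rfl
  refine exists_solOn_pos hGCM (u := fun i => c i) (i₀ := j) ⟨fun i hi => ?_, fun i hi => ?_,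
    fun i hi => ?_⟩ ?_ (hconn j hjK)
  · exact Int.cast_pos.mpr (hsupp i hi)
  · simp [hcK i hi]
  · rw [hcast]
    exact Int.cast_nonneg (hdom i hi)
  · rw [hcast]
    exact_mod_cast lt_of_le_of_ne (hdom j hjK) hj.symm

/-- Finitely many weights occur in a finite-dimensional subspace. -/
lemma finite_of_ws_le {P : Set (I → ℤ)} {N : Submodule ℂ g} [FiniteDimensional ℂ N]
    (h : ∀ c ∈ P, G.ws (G.lat c) ≤ N) : {c | c ∈ P ∧ G.ws (G.lat c) ≠ ⊥}.Finite := by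
  set Q := {c | c ∈ P ∧ G.ws (G.lat c) ≠ ⊥}
  have hx : ∀ c : Q, ∃ x ∈ G.ws (G.lat c), x ≠ 0 := fun c =>
    Submodule.exists_mem_ne_zero_of_ne_bot c.2.2
  choose x hx hx0 using hx
  have hind : iSupIndep fun c : Q => G.ws (G.lat c) :=
    (iSupIndep_wtSpaceι G.H.subtype).comp (f := fun c : Q => G.lat c)
      fun c d hcd => Subtype.ext (G.lat_injective hcd)
  have hli : LinearIndependent ℂ x := hind.linearIndependent _ hx hx0
  have hli' : LinearIndependent ℂ fun c : Q => (⟨x c, h c c.2.1 (hx c)⟩ : N) :=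
    LinearIndependent.of_comp N.subtype hli
  exact Set.finite_coe_iff.mp hli'.finite

end KacMoodyAlgebra

end FiniteType

section Rank1

variable {I : Type*} [Fintype I] [DecidableEq I] {A : Matrix I I ℤ}
variable {g : Type*} [LieRing g] [LieAlgebra ℂ g]

namespace KacMoodyAlgebra

variable (G : KacMoodyAlgebra A g)

lemma nPos_singleton_le (i : I) : (G.nPos {i}).toSubmodule ≤ G.ws (G.root i) := by
  have h : (G.nPos {i}).toSubmodule ≤ ℂ ∙ G.e i := by
    intro x hx
    induction hx using LieSubalgebra.lieSpan_induction with
    | mem y hy =>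
      obtain ⟨j, hj, rfl⟩ := hy
      rw [Set.mem_singleton_iff.mp hj]
      exact Submodule.mem_span_singleton_self _
    | zero => exact zero_mem _
    | add _ _ _ _ hu hv => exact add_mem hu hv
    | smul t _ _ hu => exact Submodule.smul_mem _ t hu
    | lie x y _ _ hu hv =>
      obtain ⟨a, rfl⟩ := Submodule.mem_span_singleton.mp hu
      obtain ⟨b, rfl⟩ := Submodule.mem_span_singleton.mp hv
      simp
  exact h.trans ((Submodule.span_singleton_le_iff_mem _ _).mpr (G.e_mem_ws i))

lemma eq_one_of_ws_ne_bot {i : I} {n : ℤ} (hn : 0 < n) (h : G.ws (G.lat (Pi.single i n)) ≠ ⊥) :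
    n = 1 := by
  have hc : G.lat (Pi.single i n) ∈ G.cone {i} := by
    refine ⟨Pi.single i n, ?_, by simpa using hn.ne', fun j hj => ?_, rfl⟩
    · intro j
      by_cases hj : j = i
      · subst hj; simpa using hn.le
      · simp [hj]
    · have hj : j ≠ i := hj
      simp [hj]
  obtain ⟨x, hx, hx0⟩ := Submodule.exists_mem_ne_zero_of_ne_bot h
  have hx' := G.nPos_singleton_le i (G.wtSum_cone_le {i} (wtSpaceι_le_wtSum hc hx))
  by_contra hne
  refine hx0 (Submodule.disjoint_def.mp ((iSupIndep_wtSpaceι G.H.subtype).pairwiseDisjoint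
    (i := G.lat (Pi.single i n)) (j := G.root i) ?_) x hx hx')
  rw [← lat_single]
  intro h
  have := congrFun (G.lat_injective h) i
  simp at this
  exact hne this

lemma abs_le_one_of_ws_ne_bot {i : I} {n : ℤ} (h : G.ws (G.lat (Pi.single i n)) ≠ ⊥) :
    n = 0 ∨ n = 1 ∨ n = -1 := by
  rcases lt_trichotomy n 0 with hn | hn | hn
  · have := G.op.eq_one_of_ws_ne_bot (i := i) (n := -n) (by lia) (by
      rw [op_lat, Pi.single_neg, lat_neg, neg_neg]; exact h)
    lia
  · exact Or.inl hn
  · exact Or.inr (Or.inl (G.eq_one_of_ws_ne_bot hn h))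

lemma mem_corootSpan_of_mem_gS {K : Set I} {x : g} (hx : x ∈ gS G K) (hH : x ∈ G.H) :
    x ∈ G.corootSpan K := by
  obtain ⟨y, hy, n, hn, rfl⟩ := Submodule.mem_sup.mp (G.gS_le_tri K hx)
  obtain ⟨t, ht, p, hp, rfl⟩ := Submodule.mem_sup.mp hy
  have h0 : p + n = 0 := by
    refine eq_zero_of_mem_wtSum (ι := G.H.subtype) (P := {0}) (Q := G.cone K ∪ G.op.cone K) ?_ ?_ ?_
    · rw [Set.disjoint_singleton_left]
      exact fun h => h.elim (G.zero_notMem_cone K) (G.op.zero_notMem_cone K)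
    · refine G.H_le_wtSum ?_
      have := sub_mem hH (G.corootSpan_le_H K ht)
      rwa [add_assoc, add_sub_cancel_left] at this
    · exact add_mem (wtSum_mono Set.subset_union_left (G.nPos_le_wtSum K hp))
        (wtSum_mono Set.subset_union_right (G.op.nPos_le_wtSum K hn))
  rw [add_assoc, h0, add_zero]
  exact ht

end KacMoodyAlgebra

end Rank1

section ResSet

variable {I S : Type*} [Fintype I] [DecidableEq S]

/-- The vertices with restriction `0` or `γ_s`. -/
def resSet (N : I → S → ℤ) (s : S) : Set I := {i | N i = 0 ∨ N i = Pi.single s 1}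

lemma sum_eq_single_of_resSet {N : I → S → ℤ} {s : S} {c : I → ℤ} (hc : ∀ i ∉ resSet N s, c i = 0) :
    (fun t => ∑ i, c i * N i t) = Pi.single s (∑ i, c i * N i s) := by
  funext t
  by_cases ht : t = s
  · subst ht; simp
  · rw [Pi.single_eq_of_ne ht]
    refine Finset.sum_eq_zero fun i _ => ?_
    by_cases hi : i ∈ resSet N s
    · rcases hi with hi | hi <;> simp [hi, ht]
    · simp [hc i hi]

end ResSet

section GradingFacts

open KacMoodyAlgebra

variable {I : Type*} [Fintype I] [DecidableEq I] {A : Matrix I I ℤ}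
variable {g : Type*} [LieRing g] [LieAlgebra ℂ g]
variable {S : Type*} [Fintype S] [DecidableEq S] {B : Matrix S S ℤ}
variable {m : Type*} [LieRing m] [LieAlgebra ℂ m]

/-- The weight space of `g` for the Cartan subalgebra of the grading subalgebra. -/
abbrev grSp (M : KacMoodyAlgebra B m) (φ : m →ₗ⁅ℂ⁆ g) (γ : Dual ℂ M.H) : Submodule ℂ g :=
  wtSpaceι (φ.toLinearMap ∘ₗ M.H.subtype) γ

variable {G : KacMoodyAlgebra A g} {M : KacMoodyAlgebra B m} {φ : m →ₗ⁅ℂ⁆ g}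
  {hle : M.H.map φ.toLinearMap ≤ G.H}

lemma eq_of_grSp_ne_bot (hgr : IsFinGrading M φ) {γ : Dual ℂ M.H} (h : grSp M φ γ ≠ ⊥) :
    γ ∈ insert 0 (Delta M) := by
  by_contra hn
  refine h (eq_bot_iff.mpr fun x hx => ?_)
  have htop : wtSum (φ.toLinearMap ∘ₗ M.H.subtype) (insert 0 (Delta M)) = ⊤ := hgr.2.1
  exact eq_zero_of_mem_wtSum (P := {γ}) (Set.disjoint_singleton_left.mpr hn)
    (wtSpaceι_le_wtSum (Set.mem_singleton γ) hx) (htop ▸ Submodule.mem_top)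

lemma finiteDimensional_grSp (hgr : IsFinGrading M φ) (γ : Dual ℂ M.H) :
    FiniteDimensional ℂ (grSp M φ γ) := by
  by_cases h : grSp M φ γ = ⊥
  · rw [h]; infer_instance
  · exact hgr.2.2 γ (eq_of_grSp_ne_bot hgr h)

lemma ws_le_grSp (χ : Dual ℂ G.H) : G.ws χ ≤ grSp M φ (resD G M φ hle χ) :=
  fun _ hx v => hx (cartanIncl G M φ hle v)

lemma grSp_le (γ : Dual ℂ M.H) :
    grSp M φ γ ≤ wtSum G.H.subtype {χ | resD G M φ hle χ = γ ∧ G.ws χ ≠ ⊥} := by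
  set P := {χ | resD G M φ hle χ = γ ∧ G.ws χ ≠ ⊥}
  set Q := {χ | resD G M φ hle χ ≠ γ}
  have htop : (⊤ : Submodule ℂ g) ≤ wtSum G.H.subtype P ⊔ wtSum G.H.subtype Q := by
    rw [← G.weight_decomp]
    refine iSup_le fun χ => ?_
    by_cases hχ : resD G M φ hle χ = γ
    · by_cases h0 : G.ws χ = ⊥
      · exact h0.le.trans bot_le
      · exact le_sup_of_le_left (wtSpaceι_le_wtSum ⟨hχ, h0⟩)
    · exact le_sup_of_le_right (wtSpaceι_le_wtSum hχ)
  intro x hx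
  obtain ⟨p, hp, q, hq, rfl⟩ := Submodule.mem_sup.mp (htop (Submodule.mem_top (x := x)))
  have hp' : p ∈ grSp M φ γ :=
    wtSum_le.mpr (fun χ hχ => hχ.1 ▸ ws_le_grSp (hle := hle) χ) hp
  have hq' : q ∈ grSp M φ γ := by simpa using sub_mem hx hp'
  have hq0 : q = 0 := by
    refine eq_zero_of_mem_wtSum (ι := φ.toLinearMap ∘ₗ M.H.subtype) (P := {γ}) (Q := {γ}ᶜ)
      disjoint_compl_right (wtSpaceι_le_wtSum (Set.mem_singleton γ) hq') ?_
    exact wtSum_le.mpr (fun χ hχ => (ws_le_grSp (hle := hle) χ).trans (wtSpaceι_le_wtSum hχ)) hq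
  simpa [hq0] using hp

lemma map_e_mem_grSp (s : S) : φ (M.e s) ∈ grSp M φ (M.root s) := fun v => by
  have := congrArg φ (M.lie_e v s)
  simpa using this

/-- The restriction of the simple roots of `G` to the Cartan subalgebra of `M` is described by the
matrix of nonnegative integers `N`. -/
def IsRes (G : KacMoodyAlgebra A g) (M : KacMoodyAlgebra B m) (φ : m →ₗ⁅ℂ⁆ g)
    (hle : M.H.map φ.toLinearMap ≤ G.H) (N : I → S → ℤ) : Prop :=
  (∀ i, 0 ≤ N i) ∧ ∀ i, resRoot G M φ hle i = M.lat (N i)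

lemma exists_isRes (hGCM : IsGCM A) (hadapt : Adapted G M φ hle) : ∃ N, IsRes G M φ hle N := by
  have h : ∀ i, ∃ n : S → ℤ, 0 ≤ n ∧ resRoot G M φ hle i = M.lat n := by
    intro i
    have hpos : G.root i ∈ posRoots G := by
      refine ⟨⟨G.indepRoot.ne_zero i, G.ws_root_ne_bot hGCM i⟩, Pi.single i 1, ?_⟩
      rw [Finset.sum_eq_single i] <;> simp +contextual
    rcases hadapt _ hpos with h | ⟨-, c, hc⟩
    · exact ⟨0, le_rfl, by rw [lat_zero]; exact h⟩
    · exact ⟨fun s => c s, fun s => Int.natCast_nonneg _, by rw [resRoot, hc]; simp [lat]⟩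
  choose N hN using h
  exact ⟨N, fun i => (hN i).1, fun i => (hN i).2⟩

namespace IsRes

variable {N : I → S → ℤ}

lemma op (hN : IsRes G M φ hle N) : IsRes G.op M.op φ hle N :=
  ⟨hN.1, fun i => by
    rw [op_lat, ← hN.2 i]
    rfl⟩

lemma mem_Jof (hN : IsRes G M φ hle N) {i : I} : i ∈ Jof G M φ hle ↔ N i = 0 := by
  rw [Jof, Set.mem_ofPred_eq, hN.2, ← M.lat_zero, M.lat_injective.eq_iff]

lemma mem_GammaOf (hN : IsRes G M φ hle N) {i : I} {s : S} :
    resRoot G M φ hle i = M.root s ↔ N i = Pi.single s 1 := by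
  rw [hN.2, ← M.lat_single, M.lat_injective.eq_iff]

lemma resD_lat (hN : IsRes G M φ hle N) (c : I → ℤ) :
    resD G M φ hle (G.lat c) = M.lat fun s => ∑ i, c i * N i s := by
  have h : resD G M φ hle (G.lat c) = ∑ i, (c i : ℂ) • resRoot G M φ hle i := by
    ext v
    simp [resD, lat, resRoot]
  rw [h]
  simp only [hN.2, lat, Finset.smul_sum, smul_smul]
  rw [Finset.sum_comm]
  simp [Finset.sum_smul]

lemma coeff (hN : IsRes G M φ hle N) (hgr : IsFinGrading M φ) {s : S} {c : I → ℤ}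
    (hc : ∀ i ∉ resSet N s, c i = 0) (hw : G.ws (G.lat c) ≠ ⊥) :
    ∑ i, c i * N i s = 0 ∨ ∑ i, c i * N i s = 1 ∨ ∑ i, c i * N i s = -1 := by
  have h1 : grSp M φ (M.lat (Pi.single s (∑ i, c i * N i s))) ≠ ⊥ := by
    rw [← sum_eq_single_of_resSet hc, ← hN.resD_lat]
    exact fun h => hw (eq_bot_iff.mpr (h ▸ ws_le_grSp _))
  rcases eq_of_grSp_ne_bot hgr h1 with h2 | h2
  · left
    have := congrFun (M.lat_injective (h2.trans M.lat_zero.symm)) s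
    simpa using this
  · exact M.abs_le_one_of_ws_ne_bot h2.2

lemma isFiniteType_resSet (hN : IsRes G M φ hle N) (hgr : IsFinGrading M φ) (hGCM : IsGCM A)
    (s : S) : IsFiniteType (restrictM A (resSet N s)) := by
  refine G.isFiniteType_of_finite hGCM ?_
  have : ∀ γ, FiniteDimensional ℂ (grSp M φ γ) := finiteDimensional_grSp hgr
  refine (G.finite_of_ws_le (N := grSp M φ 0 ⊔ grSp M φ (M.lat (Pi.single s 1)) ⊔
    grSp M φ (M.lat (Pi.single s (-1))))
    (P := {c | (∀ i ∉ resSet N s, c i = 0) ∧ (∑ i, c i * N i s = 0 ∨ ∑ i, c i * N i s = 1 ∨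
      ∑ i, c i * N i s = -1)}) ?_).subset fun c hc => ⟨⟨hc.1, hN.coeff hgr hc.1 hc.2⟩, hc.2⟩
  rintro c ⟨hc, h⟩
  have h1 := ws_le_grSp (G := G) (M := M) (φ := φ) (hle := hle) (G.lat c)
  rw [hN.resD_lat, sum_eq_single_of_resSet hc] at h1
  rcases h with h | h | h <;> rw [h] at h1
  · rw [Pi.single_zero, lat_zero] at h1
    exact h1.trans (le_sup_of_le_left le_sup_left)
  · exact h1.trans (le_sup_of_le_left le_sup_right)
  · exact h1.trans le_sup_right

lemma isFiniteType_Jof (hN : IsRes G M φ hle N) (hgr : IsFinGrading M φ) (hGCM : IsGCM A) :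
    IsFiniteType (restrictM A (Jof G M φ hle)) := by
  refine G.isFiniteType_of_finite hGCM ?_
  have := finiteDimensional_grSp hgr 0
  refine G.finite_of_ws_le (N := grSp M φ 0) (P := {c | ∀ i ∉ Jof G M φ hle, c i = 0}) ?_
  intro c hc
  have h1 := ws_le_grSp (G := G) (M := M) (φ := φ) (hle := hle) (G.lat c)
  rw [hN.resD_lat] at h1
  convert h1 using 2
  rw [← M.lat_zero]
  congr 1
  funext s
  refine (Finset.sum_eq_zero fun i _ => ?_).symm
  by_cases hi : i ∈ Jof G M φ hle
  · simp [hN.mem_Jof.mp hi]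
  · simp [hc i hi]

lemma map_e_mem (hN : IsRes G M φ hle N) (s : S) : φ (M.e s) ∈ G.nPos (resSet N s) := by
  refine G.wtSum_cone_le _ (wtSum_mono ?_ (grSp_le (hle := hle) _ (map_e_mem_grSp s)))
  rintro χ ⟨hχ, hw⟩
  rw [← lat_single] at hχ
  rcases G.mem_of_ws_ne_bot hw with h | ⟨c, hc, h0, -, h⟩ | ⟨d, hd, h0, -, h⟩
  · rw [h, ← G.lat_zero, hN.resD_lat] at hχ
    have := congrFun (M.lat_injective hχ) s
    simp at this
  · rw [h, hN.resD_lat] at hχ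
    refine ⟨c, hc, h0, fun i hi => ?_, h⟩
    by_contra hci
    have hci : 1 ≤ c i := by have := hc i; simp at this; lia
    have hle' : ∀ t, N i t ≤ (Pi.single s 1 : S → ℤ) t := by
      intro t
      rw [← M.lat_injective hχ]
      refine le_trans ?_ (Finset.single_le_sum (f := fun i => c i * N i t)
        (fun j _ => mul_nonneg (hc j) (hN.1 j t)) (Finset.mem_univ i))
      exact le_mul_of_one_le_left (hN.1 i t) hci
    have hz : ∀ t, t ≠ s → N i t = 0 := fun t ht =>
      le_antisymm (by simpa [ht] using hle' t) (hN.1 i t)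
    have hs : N i s = 0 ∨ N i s = 1 := by
      have h1 := hle' s
      have h2 := hN.1 i s
      simp at h1 h2
      lia
    refine hi (hs.imp (fun h => ?_) fun h => ?_) <;> funext t <;> by_cases ht : t = s
    · simp [ht, h]
    · simp [hz t ht]
    · simp [ht, h]
    · simp [hz t ht, ht]
  · rw [h, op_lat, ← lat_neg, hN.resD_lat] at hχ
    have h1 := congrFun (M.lat_injective hχ) s
    have h2 : ∑ i, (-d) i * N i s ≤ 0 := Finset.sum_nonpos fun i _ =>
      mul_nonpos_of_nonpos_of_nonneg (by simpa using hd i) (hN.1 i s)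
    simp at h1 h2
    lia

lemma map_f_mem (hN : IsRes G M φ hle N) (s : S) : φ (M.f s) ∈ G.op.nPos (resSet N s) :=
  hN.op.map_e_mem s

lemma map_coroot_mem (hN : IsRes G M φ hle N) (s : S) :
    φ (M.coroot s) ∈ G.corootSpan (resSet N s) := by
  refine G.mem_corootSpan_of_mem_gS ?_ (hle (Submodule.mem_map_of_mem (M.coroot s).2))
  have h : φ (M.coroot s) = ⁅φ (M.e s), φ (M.f s)⁆ := by
    rw [← LieHom.map_lie, M.e_f, if_pos rfl]
  rw [h]
  refine (gS G _).lie_mem (G.nPos_le_gS _ (hN.map_e_mem s)) ?_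
  rw [← G.op_gS]
  exact G.op.nPos_le_gS _ (hN.map_f_mem s)

lemma root_map_coroot (hN : IsRes G M φ hle N) (i : I) (s : S) :
    G.root i (cartanIncl G M φ hle (M.coroot s)) = ((∑ t, B s t * N i t : ℤ) : ℂ) := by
  rw [← M.lat_apply_coroot, ← hN.2 i]
  rfl

end IsRes

end GradingFacts

section GradedComponents

open KacMoodyAlgebra

variable {I : Type*} [Fintype I] [DecidableEq I] {A : Matrix I I ℤ}
variable {g : Type*} [LieRing g] [LieAlgebra ℂ g]
variable {S : Type*} [Fintype S] [DecidableEq S] {B : Matrix S S ℤ}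
variable {m : Type*} [LieRing m] [LieAlgebra ℂ m]

namespace KacMoodyAlgebra

variable (G : KacMoodyAlgebra A g)

lemma op_corootSpan (K : Set I) : G.op.corootSpan K = G.corootSpan K := by
  have h : G.op.coroot '' K = -(G.coroot '' K) := by
    rw [← Set.image_neg_eq_neg, Set.image_image]
  rw [corootSpan, corootSpan, h, Submodule.span_neg]

lemma lie_corootSpan_nPos {C D : Set I} (hDC : ∀ i ∈ D, ∀ j ∈ C, A i j = 0) {z x : g}
    (hz : z ∈ G.corootSpan D) (hx : x ∈ G.nPos C) : ⁅z, x⁆ = 0 := by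
  obtain ⟨z, hz, rfl⟩ := hz
  have hroot : ∀ j ∈ C, G.root j z = 0 := by
    intro j hj
    induction hz using Submodule.span_induction with
    | mem w hw =>
      obtain ⟨i, hi, rfl⟩ := hw
      rw [G.pairing, hDC i hi j hj, Int.cast_zero]
    | zero => simp
    | add _ _ _ _ h1 h2 => rw [map_add, h1, h2, add_zero]
    | smul t _ _ h => rw [map_smul, h, smul_zero]
  refine lie_lieSpan_lieSpan_eq_zero (s := {(z : g)}) ?_
    (LieSubalgebra.subset_lieSpan (Set.mem_singleton _)) hx
  rintro _ hw _ ⟨j, hj, rfl⟩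
  rw [Set.mem_singleton_iff.mp hw, G.lie_e, hroot j hj, zero_smul]

lemma gS_sub_corootSpan {C : Set I} {x : g} (hx : x ∈ gS G C) :
    ∃ h ∈ G.corootSpan C, ∃ w ∈ wtSum G.H.subtype (G.cone C ∪ G.op.cone C), x = h + w := by
  obtain ⟨y, hy, n, hn, rfl⟩ := Submodule.mem_sup.mp (G.gS_le_tri C hx)
  obtain ⟨t, ht, p, hp, rfl⟩ := Submodule.mem_sup.mp hy
  exact ⟨t, ht, p + n, add_mem (wtSum_mono Set.subset_union_left (G.nPos_le_wtSum C hp))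
    (wtSum_mono Set.subset_union_right (G.op.nPos_le_wtSum C hn)), add_assoc _ _ _⟩

/-- If a sum of elements of two orthogonal subalgebras lies in the Cartan subalgebra, so do the
summands. -/
lemma mem_corootSpan_of_add_mem {C D : Set I} (hdisj : Disjoint C D) {x y : g}
    (hx : x ∈ gS G C) (hy : y ∈ gS G D) (hxy : x + y ∈ G.H) : x ∈ G.corootSpan C := by
  obtain ⟨h, hh, w, hw, rfl⟩ := G.gS_sub_corootSpan hx
  obtain ⟨h', hh', w', hw', rfl⟩ := G.gS_sub_corootSpan hy
  have h0 : w + w' = 0 := by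
    refine eq_zero_of_mem_wtSum (ι := G.H.subtype) (P := {0})
      (Q := (G.cone C ∪ G.op.cone C) ∪ (G.cone D ∪ G.op.cone D)) ?_ (G.H_le_wtSum ?_)
      (add_mem (wtSum_mono Set.subset_union_left hw) (wtSum_mono Set.subset_union_right hw'))
    · rw [Set.disjoint_singleton_left]
      rintro ((h | h) | (h | h))
      exacts [G.zero_notMem_cone _ h, G.op.zero_notMem_cone _ h, G.zero_notMem_cone _ h,
        G.op.zero_notMem_cone _ h]
    · have := sub_mem hxy (add_mem (G.corootSpan_le_H C hh) (G.corootSpan_le_H D hh'))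
      rwa [add_add_add_comm, add_sub_cancel_left] at this
  have hw0 : w = 0 := by
    refine eq_zero_of_mem_wtSum (ι := G.H.subtype) (P := G.cone C ∪ G.op.cone C)
      (Q := G.cone D ∪ G.op.cone D) ?_ hw (by rw [eq_neg_of_add_eq_zero_left h0]; exact neg_mem hw')
    rw [Set.disjoint_union_left, Set.disjoint_union_right, Set.disjoint_union_right]
    exact ⟨⟨G.disjoint_cone hdisj, G.disjoint_cone_op _ _⟩,
      (G.disjoint_cone_op _ _).symm, G.op.disjoint_cone hdisj⟩
  rw [hw0, add_zero]
  exact hh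

lemma nPos_inf_nPos {C D : Set I} (hdisj : Disjoint C D) {x : g} (hC : x ∈ G.nPos C)
    (hD : x ∈ G.nPos D) : x = 0 :=
  eq_zero_of_mem_wtSum (G.disjoint_cone hdisj) (G.nPos_le_wtSum C hC) (G.nPos_le_wtSum D hD)

/-- The component in `nPos C` of an eigenvector in `nPos (C ∪ D)` is an eigenvector. -/
lemma lie_eq_smul_of_add {C D : Set I} (hdisj : Disjoint C D) (hCD : ∀ i ∈ C, ∀ j ∈ D, A i j = 0)
    (hDC : ∀ i ∈ D, ∀ j ∈ C, A i j = 0) {z z' x x' : g} {a : ℂ} (hz : z ∈ G.corootSpan C)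
    (hz' : z' ∈ G.corootSpan D) (hx : x ∈ G.nPos C) (hx' : x' ∈ G.nPos D)
    (h : ⁅z + z', x + x'⁆ = a • (x + x')) : ⁅z, x⁆ = a • x := by
  rw [add_lie, lie_add, lie_add, G.lie_corootSpan_nPos hCD hz hx',
    G.lie_corootSpan_nPos hDC hz' hx, add_zero, zero_add, smul_add] at h
  have h1 : ⁅z, x⁆ - a • x = a • x' - ⁅z', x'⁆ := by
    rw [sub_eq_sub_iff_add_eq_add, h, add_comm]
  refine sub_eq_zero.mp (G.nPos_inf_nPos hdisj
    (sub_mem (G.lie_H_nPos (G.corootSpan_le_H C hz) hx) ((G.nPos C).smul_mem a hx)) ?_)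
  rw [h1]
  exact sub_mem ((G.nPos D).smul_mem a hx') (G.lie_H_nPos (G.corootSpan_le_H D hz') hx')

end KacMoodyAlgebra

namespace IsRes

variable {G : KacMoodyAlgebra A g} {M : KacMoodyAlgebra B m} {φ : m →ₗ⁅ℂ⁆ g}
  {hle : M.H.map φ.toLinearMap ≤ G.H} {N : I → S → ℤ}

/-- A connected component of the diagram on `J ∪ Γ_s` contains at most one element of `Γ_s`. -/
lemma eq_of_mem_cmpnt (hN : IsRes G M φ hle N) (hgr : IsFinGrading M φ) (hGCM : IsGCM A) {s : S}
    {k l : I} (hk : N k = Pi.single s 1) (hl : N l = Pi.single s 1)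
    (hlk : l ∈ cmpnt A (resSet N s) k) : l = k := by
  by_contra hne
  have hkT : k ∈ resSet N s := Or.inr hk
  obtain ⟨c, hc, hsupp, hw⟩ := G.exists_ws_ne_bot_of_cmpnt hGCM hkT
  have hcT : ∀ i ∉ resSet N s, c i = 0 := fun i hi => by
    by_contra h
    exact hi (cmpnt_subset ((hsupp i).mp h))
  have hck : 1 ≤ c k := by
    have := hc k
    have := (hsupp k).mpr (self_mem_cmpnt hkT)
    simp at *
    lia
  have hcl : 1 ≤ c l := by
    have := hc l
    have := (hsupp l).mpr hlk
    simp at *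
    lia
  have h2 : c l * N l s + c k * N k s ≤ ∑ i, c i * N i s := by
    rw [← Finset.sum_pair (f := fun i => c i * N i s) hne]
    exact Finset.sum_le_sum_of_subset_of_nonneg (Finset.subset_univ _)
      fun i _ _ => mul_nonneg (hc i) (hN.1 i s)
  simp only [hk, hl, Pi.single_eq_same, mul_one] at h2
  rcases hN.coeff hgr hcT hw with h | h | h <;> lia

lemma cmpnt_eq (hN : IsRes G M φ hle N) (hgr : IsFinGrading M φ) (hGCM : IsGCM A) {s : S}
    {k : I} (hk : N k = Pi.single s 1) :
    cmpnt A (Jof G M φ hle ∪ {k}) k = cmpnt A (resSet N s) k := by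
  have h1 : Jof G M φ hle ∪ {k} ⊆ resSet N s := by
    rintro i (hi | hi)
    · exact Or.inl (hN.mem_Jof.mp hi)
    · exact Or.inr (by rw [Set.mem_singleton_iff.mp hi, hk])
  have h2 : cmpnt A (resSet N s) k ⊆ Jof G M φ hle ∪ {k} := by
    intro i hi
    rcases hi.1 with h | h
    · exact Or.inl (hN.mem_Jof.mpr h)
    · exact Or.inr (hN.eq_of_mem_cmpnt hgr hGCM hk h hi)
  ext i
  refine ⟨fun hi => ⟨h1 hi.1, hi.2.lift id fun x y h => ⟨h1 h.1, h1 h.2.1, h.2.2⟩⟩,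
    fun hi => ⟨h2 hi, (reflTransGen_cmpnt hi).lift id fun x y h => ⟨h2 h.1, h2 h.2.1, h.2.2⟩⟩⟩

lemma cAdmissibleComponent (hN : IsRes G M φ hle N) (hgr : IsFinGrading M φ) (hGCM : IsGCM A)
    (hBgcm : IsGCM B) {s : S} {k : I} (hk : N k = Pi.single s 1) :
    CAdmissibleComponent G (Jof G M φ hle) k := by
  rw [CAdmissibleComponent, hN.cmpnt_eq hgr hGCM hk]
  have hkT : k ∈ resSet N s := Or.inr hk
  have hsub : cmpnt A (resSet N s) k ⊆ resSet N s := cmpnt_subset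
  refine ⟨isFiniteType_restrictM_mono hGCM hsub (hN.isFiniteType_resSet hgr hGCM s), ?_⟩
  have hkC : k ∈ cmpnt A (resSet N s) k := self_mem_cmpnt hkT
  have hCN : ∀ i ∈ cmpnt A (resSet N s) k, i ≠ k → N i = 0 := fun i hi hik =>
    (hsub hi).resolve_right fun h => hik (hN.eq_of_mem_cmpnt hgr hGCM hk h hi)
  obtain ⟨D, hdisj, hunion, hCD⟩ : ∃ D, Disjoint (cmpnt A (resSet N s) k) D ∧
      cmpnt A (resSet N s) k ∪ D = resSet N s ∧
      ∀ i ∈ cmpnt A (resSet N s) k, ∀ j ∈ D, A i j = 0 := by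
    refine ⟨resSet N s \ cmpnt A (resSet N s) k, disjoint_sdiff_self_right,
      Set.union_sdiff_cancel hsub, fun i hi j hj => ?_⟩
    by_contra h
    exact hj.2 (mem_cmpnt_of_adj hi hj.1 h)
  generalize cmpnt A (resSet N s) k = C at *
  have hDC : ∀ i ∈ D, ∀ j ∈ C, A i j = 0 := fun i hi j hj => hGCM.2.2 _ _ (hCD j hj i hi)
  have hX := hN.map_e_mem s
  have hY := hN.map_f_mem s
  rw [← hunion] at hX hY
  obtain ⟨E, hE, E', hE', hXE⟩ := Submodule.mem_sup.mp (G.nPos_union_le hdisj hCD hX)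
  obtain ⟨F, hF, F', hF', hYF⟩ := Submodule.mem_sup.mp (G.op.nPos_union_le hdisj hCD hY)
  have hEC : E ∈ gS G C := G.nPos_le_gS C hE
  have hED : E' ∈ gS G D := G.nPos_le_gS D hE'
  have hFC : F ∈ gS G C := by rw [← G.op_gS]; exact G.op.nPos_le_gS C hF
  have hFD : F' ∈ gS G D := by rw [← G.op_gS]; exact G.op.nPos_le_gS D hF'
  have hZ : φ (M.coroot s) = ⁅E, F⁆ + ⁅E', F'⁆ := by
    have h : φ (M.coroot s) = ⁅φ (M.e s), φ (M.f s)⁆ := by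
      rw [← LieHom.map_lie, M.e_f, if_pos rfl]
    rw [h, ← hXE, ← hYF, add_lie, lie_add, lie_add, G.gS_lie_gS_eq_zero hdisj hCD hEC hFD,
      G.gS_lie_gS_eq_zero hdisj.symm hDC hED hFC, add_zero, zero_add]
  have hZH : ⁅E, F⁆ + ⁅E', F'⁆ ∈ G.H := by
    rw [← hZ]
    exact hle (Submodule.mem_map_of_mem (M.coroot s).2)
  have hz := G.mem_corootSpan_of_add_mem hdisj ((gS G C).lie_mem hEC hFC)
    ((gS G D).lie_mem hED hFD) hZH
  have hz' := G.mem_corootSpan_of_add_mem hdisj.symm ((gS G D).lie_mem hED hFD)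
    ((gS G C).lie_mem hEC hFC) (by rwa [add_comm])
  have hE2 : ⁅⁅E, F⁆, E⁆ = (2 : ℂ) • E := by
    refine G.lie_eq_smul_of_add hdisj hCD hDC hz hz' hE hE' ?_
    rw [← hZ, hXE, ← LieHom.map_lie, M.lie_e, M.root_coroot_self (hBgcm.1 s), map_smul]
  have hF2 : ⁅⁅E, F⁆, F⁆ = (-2 : ℂ) • F := by
    refine G.op.lie_eq_smul_of_add hdisj hCD hDC ?_ ?_ hF hF' (z' := ⁅E', F'⁆) ?_
    · rw [op_corootSpan]; exact hz
    · rw [op_corootSpan]; exact hz'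
    · rw [← hZ, hYF, ← LieHom.map_lie, M.lie_f, M.root_coroot_self (hBgcm.1 s), map_smul]
  obtain ⟨Hk, hHk, hHkz⟩ := hz
  obtain ⟨Hk', hHk', hHkz'⟩ := hz'
  simp only [Submodule.subtype_apply] at hHkz hHkz'
  have hsum : cartanIncl G M φ hle (M.coroot s) = Hk + Hk' := by
    apply Subtype.ext
    rw [Submodule.coe_add, hHkz, hHkz', ← hZ]
    rfl
  have hgen : ∀ i ∈ C, G.root i Hk = if i = k then 2 else 0 := by
    intro i hi
    have h0 : G.root i Hk' = 0 := by
      have h := G.lie_corootSpan_nPos hDC (C := C) (D := D) (z := Hk')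
        (Submodule.mem_map_of_mem (f := G.H.subtype) hHk') (G.e_mem_nPos hi)
      rw [G.lie_e] at h
      exact (smul_eq_zero.mp h).resolve_right (G.isSl2Triple (hGCM.1 i)).e_ne_zero
    have h1 := hN.root_map_coroot i s
    rw [hsum, map_add, h0, add_zero] at h1
    rw [h1]
    split_ifs with hik
    · rw [hik, hk, Finset.sum_eq_single s] <;> simp +contextual [hBgcm.1 s]
    · simp [hCN i hi hik]
  refine ⟨Hk, ⟨hHk, hgen⟩, E, F, hEC, hFC, ?_, ?_⟩
  · rw [hHkz]
    refine ⟨fun h => ?_, rfl, ?_, ?_⟩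
    · have h0 : Hk = 0 := Subtype.ext (hHkz.trans h)
      have := hgen k hkC
      simp [h0] at this
    · rw [hE2, ← Nat.cast_smul_eq_nsmul ℂ]; norm_num
    · rw [hF2, ← Nat.cast_smul_eq_nsmul ℂ]; simp
  · intro x hx
    have hwt : ∀ c : I → ℤ, (∀ i ∉ C, c i = 0) → G.ws (G.lat c) ≠ ⊥ →
        G.lat c Hk = 0 ∨ G.lat c Hk = 2 ∨ G.lat c Hk = -2 := by
      intro c hc hw
      have hcT : ∀ i ∉ resSet N s, c i = 0 := fun i hi => hc i fun h => hi (hsub h)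
      have h1 : G.lat c Hk = (c k : ℂ) * 2 := by
        rw [lat, LinearMap.sum_apply, Finset.sum_eq_single k]
        · simp [hgen k hkC]
        · intro i _ hik
          by_cases hi : i ∈ C
          · simp [hgen i hi, hik]
          · simp [hc i hi]
        · simp
      have h2 : ∑ i, c i * N i s = c k := by
        rw [Finset.sum_eq_single k]
        · simp [hk]
        · intro i _ hik
          by_cases hi : i ∈ C
          · simp [hCN i hi hik]
          · simp [hc i hi]
        · simp
      have h3 := hN.coeff hgr hcT hw
      rw [h2] at h3
      rcases h3 with h | h | h <;> simp [h1, h]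
    set R := Module.End.eigenspace (LieAlgebra.ad ℂ g Hk) 0 ⊔
      Module.End.eigenspace (LieAlgebra.ad ℂ g Hk) 2 ⊔
      Module.End.eigenspace (LieAlgebra.ad ℂ g Hk) (-2) with hR
    have hws : ∀ c : I → ℤ, (∀ i ∉ C, c i = 0) → G.ws (G.lat c) ≤ R := by
      intro c hc
      by_cases hw : G.ws (G.lat c) = ⊥
      · rw [hw]; exact bot_le
      · have hle' : ∀ μ, G.lat c Hk = μ → G.ws (G.lat c) ≤
            Module.End.eigenspace (LieAlgebra.ad ℂ g Hk) μ := by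
          rintro μ rfl y hy
          exact Module.End.mem_eigenspace_iff.mpr (hy Hk)
        rcases hwt c hc hw with h | h | h
        · exact (hle' _ h).trans (le_sup_of_le_left le_sup_left)
        · exact (hle' _ h).trans (le_sup_of_le_left le_sup_right)
        · exact (hle' _ h).trans le_sup_right
    obtain ⟨h, hh, w, hw, rfl⟩ := G.gS_sub_corootSpan hx
    refine add_mem ?_ ?_
    · refine hws 0 (fun _ _ => rfl) ?_
      rw [lat_zero]
      exact (G.mem_H_iff h).mp (G.corootSpan_le_H C hh)
    · refine (wtSum_le (N := R)).mpr ?_ hw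
      rintro χ (⟨c, -, -, hc, rfl⟩ | ⟨c, -, -, hc, rfl⟩)
      · exact hws c hc
      · rw [op_lat, ← lat_neg]
        exact hws _ fun i hi => by simp [hc i hi]

end IsRes

end GradedComponents

section CorootFamily

variable {I : Type*} [Fintype I] {A : Matrix I I ℤ}
variable {S : Type*} [Fintype S] [DecidableEq S] {B : Matrix S S ℤ}

/-- The coefficients `y s` (one vector for each `s : S`) of a family of coroots supported on the
sets `resSet N s`, whose pairing with the simple roots is given by `N` and `B`. -/
structure IsCorootFamily (A : Matrix I I ℤ) (B : Matrix S S ℤ) (N : I → S → ℤ)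
    (y : S → I → ℝ) : Prop where
  nonneg : ∀ s i, 0 ≤ y s i
  eq_zero : ∀ s, ∀ i ∉ resSet N s, y s i = 0
  vecMul : ∀ s j, ∑ i, y s i * A i j = ∑ t, (B s t : ℝ) * N j t
  pos : ∀ s l, N l = Pi.single s 1 → 0 < y s l
  exists_eq : ∀ s, ∃ l, N l = Pi.single s 1

/-- If `A` is symmetrizable by positive weights, so is `B`. -/
lemma IsCorootFamily.exists_symmetrizer {N : I → S → ℤ} {y : S → I → ℝ}
    (hy : IsCorootFamily A B N y) {d : I → ℚ} (hd : ∀ i, 0 < d i)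
    (hdA : ∀ i j, d i * (A i j : ℚ) = d j * (A j i : ℚ)) :
    ∃ ε : S → ℝ, (∀ s, 0 < ε s) ∧ ∀ s t, B s t * ε t = B t s * ε s := by
  have hd' : ∀ i, (0 : ℝ) < d i := fun i => by exact_mod_cast hd i
  have hdA' : ∀ i j, (A i j : ℝ) / d j = A j i / d i := by
    intro i j
    rw [div_eq_div_iff (hd' j).ne' (hd' i).ne', mul_comm, mul_comm (A j i : ℝ)]
    exact_mod_cast hdA i j
  have hpair : ∀ s t, ∑ j, (∑ i, y s i * A i j) * (y t j / d j) =
      B s t * ∑ j, N j t * (y t j / d j) := by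
    intro s t
    rw [Finset.mul_sum]
    refine Finset.sum_congr rfl fun j _ => ?_
    by_cases hj : j ∈ resSet N t
    · have h : ∑ u, (B s u : ℝ) * N j u = B s t * N j t := by
        refine Finset.sum_eq_single t (fun u _ hu => ?_) (by simp)
        rcases hj with hj | hj <;> simp [hj, hu]
      rw [hy.vecMul, h, mul_assoc]
    · simp [hy.eq_zero t j hj]
  refine ⟨fun t => ∑ j, N j t * (y t j / d j), fun t => ?_, fun s t => ?_⟩
  · obtain ⟨l, hl⟩ := hy.exists_eq t
    refine Finset.sum_pos' (fun j _ => ?_) ⟨l, Finset.mem_univ l, ?_⟩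
    · by_cases hj : j ∈ resSet N t
      · have := div_nonneg (hy.nonneg t j) (hd' j).le
        rcases hj with hj | hj <;> simp [hj, this]
      · simp [hy.eq_zero t j hj]
    · simpa [hl] using div_pos (hy.pos t l hl) (hd' l)
  · rw [← hpair, ← hpair]
    simp only [Finset.sum_mul]
    rw [Finset.sum_comm]
    refine Finset.sum_congr rfl fun i _ => Finset.sum_congr rfl fun j _ => ?_
    have := hdA' i j
    calc y s i * A i j * (y t j / d j) = y s i * y t j * (A i j / d j) := by ring
      _ = y s i * y t j * (A j i / d i) := by rw [this]
      _ = _ := by ring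

end CorootFamily

section NoImaginary

open KacMoodyAlgebra

variable {I : Type*} [Fintype I] [DecidableEq I] {A : Matrix I I ℤ}
variable {g : Type*} [LieRing g] [LieAlgebra ℂ g]
variable {S : Type*} [Fintype S] [DecidableEq S] {B : Matrix S S ℤ}
variable {m : Type*} [LieRing m] [LieAlgebra ℂ m]

namespace IsRes

variable {G : KacMoodyAlgebra A g} {M : KacMoodyAlgebra B m} {φ : m →ₗ⁅ℂ⁆ g}
  {hle : M.H.map φ.toLinearMap ≤ G.H} {N : I → S → ℤ}

lemma exists_complex_coeff (hN : IsRes G M φ hle N) (s : S) :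
    ∃ c : I → ℂ, (∀ i ∉ resSet N s, c i = 0) ∧
      cartanIncl G M φ hle (M.coroot s) = ∑ i, c i • G.coroot i := by
  obtain ⟨z, hz, hzs⟩ := hN.map_coroot_mem s
  have h : cartanIncl G M φ hle (M.coroot s) = z := Subtype.ext hzs.symm
  rw [h]
  clear h hzs
  induction hz using Submodule.span_induction with
  | mem w hw =>
    obtain ⟨i, hi, rfl⟩ := hw
    refine ⟨Pi.single i 1, fun j hj => ?_, ?_⟩
    · rw [Pi.single_eq_of_ne]
      rintro rfl
      exact hj hi
    · rw [Finset.sum_eq_single i] <;> simp +contextual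
  | zero => exact ⟨0, by simp, by simp⟩
  | add x y _ _ hx hy =>
    obtain ⟨c, hc, rfl⟩ := hx
    obtain ⟨d, hd, rfl⟩ := hy
    exact ⟨c + d, fun i hi => by simp [hc i hi, hd i hi],
      by simp [add_smul, Finset.sum_add_distrib]⟩
  | smul t x _ hx =>
    obtain ⟨c, hc, rfl⟩ := hx
    exact ⟨t • c, fun i hi => by simp [hc i hi], by simp [Finset.smul_sum, smul_smul]⟩

lemma exists_isCorootFamily (hN : IsRes G M φ hle N) (hgr : IsFinGrading M φ) (hGCM : IsGCM A)
    (hBgcm : IsGCM B) : ∃ y, IsCorootFamily A B N y := by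
  choose c hc0 hc using hN.exists_complex_coeff
  have hcA : ∀ s j, ∑ i, c s i * (A i j : ℂ) = ((∑ t, B s t * N j t : ℤ) : ℂ) := by
    intro s j
    rw [← hN.root_map_coroot, hc, map_sum]
    simp [G.pairing]
  have hre : ∀ s j, ∑ i, (c s i).re * (A i j : ℝ) = ∑ t, (B s t : ℝ) * N j t := by
    intro s j
    have := congrArg Complex.re (hcA s j)
    rw [Complex.re_sum, Complex.intCast_re] at this
    push_cast at this
    rw [← this]
    refine Finset.sum_congr rfl fun i _ => ?_
    simp [Complex.mul_re]
  have him : ∀ s, (fun i => (c s i).im) = 0 := by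
    intro s
    refine eq_zero_of_vecMul_eq_zero hGCM (hN.isFiniteType_resSet hgr hGCM s)
      (fun i hi => by simp [hc0 s i hi]) fun j _ => ?_
    have := congrArg Complex.im (hcA s j)
    rw [Complex.im_sum, Complex.intCast_im] at this
    rw [← this]
    refine Finset.sum_congr rfl fun i _ => ?_
    simp [Complex.mul_im]
  have h2 : ∀ s l, N l = Pi.single s 1 → ∑ i, (c s i).re * (A i l : ℝ) = 2 := by
    intro s l hl
    rw [hre, hl, Finset.sum_eq_single s] <;> simp +contextual [hBgcm.1 s]
  have h0 : ∀ s l, N l = 0 → ∑ i, (c s i).re * (A i l : ℝ) = 0 := by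
    intro s l hl
    simp [hre, hl]
  have hnn : ∀ s i, 0 ≤ (c s i).re := by
    intro s i
    refine nonneg_of_vecMul_nonneg hGCM (hN.isFiniteType_resSet hgr hGCM s)
      (y := fun i => (c s i).re) (fun i hi => by simp [hc0 s i hi]) (fun j hj => ?_) i
    rcases hj with hj | hj
    · exact (h0 s j hj).ge
    · rw [h2 s j hj]; norm_num
  refine ⟨fun s i => (c s i).re, hnn, fun s i hi => by simp [hc0 s i hi], hre, ?_, ?_⟩
  · intro s l hl
    refine (hnn s l).lt_of_ne fun h => ?_
    have h3 : ∑ i, (c s i).re * (A i l : ℝ) ≤ 0 := by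
      refine Finset.sum_nonpos fun i _ => ?_
      by_cases hil : i = l
      · rw [hil, ← h, zero_mul]
      · exact mul_nonpos_of_nonneg_of_nonpos (hnn s i) (by exact_mod_cast hGCM.2.1 i l hil)
    rw [h2 s l hl] at h3
    norm_num at h3
  · intro s
    by_contra! hne
    have h3 : (fun i => (c s i).re) = 0 :=
      eq_zero_of_vecMul_eq_zero hGCM (hN.isFiniteType_resSet hgr hGCM s)
        (fun i hi => by simp [hc0 s i hi]) fun j hj => h0 s j (hj.resolve_right (hne j))
    have h4 : cartanIncl G M φ hle (M.coroot s) = 0 := by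
      rw [hc]
      refine Finset.sum_eq_zero fun i _ => ?_
      have h5 : c s i = 0 := Complex.ext (congrFun h3 i) (congrFun (him s) i)
      rw [h5, zero_smul]
    refine M.indepCoroot.ne_zero s (Subtype.ext (hgr.1 ?_))
    rw [ZeroMemClass.coe_zero, map_zero]
    exact congrArg Subtype.val h4

end IsRes

namespace IsCorootFamily

variable {N : I → S → ℤ} {y : S → I → ℝ}

lemma term_nonpos (hy : IsCorootFamily A B N y) (hGCM : IsGCM A) {s : S} {j : I}
    (hj : y s j = 0) (i : I) : y s i * A i j ≤ 0 := by
  by_cases hij : i = j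
  · rw [hij, hj, zero_mul]
  · exact mul_nonpos_of_nonneg_of_nonpos (hy.nonneg s i) (by exact_mod_cast hGCM.2.1 i j hij)

lemma mul_eq_zero_of_imaginary (hy : IsCorootFamily A B N y) (hGCM : IsGCM A)
    (hSym : Symmetrizable A) (htype : IsFiniteType A ∨ IsAffineType A ∨ IsHyperbolic A)
    (hN : ∀ i, 0 ≤ N i) {k : I} (hk : ∀ s, k ∉ resSet N s) (s : S) (i : I) :
    y s i * A i k = 0 := by
  obtain ⟨d, hd, hdA⟩ := exists_pos_symmetrizer hGCM hSym
  obtain ⟨ε, hε, hεB⟩ := hy.exists_symmetrizer hd hdA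
  obtain ⟨u, hu⟩ := exists_solOn_compl hGCM htype k
  have hyk : ∀ s, y s k = 0 := fun s => hy.eq_zero s k (hk s)
  have hb : ∀ s, ∑ i, y s i * A i k ≤ 0 := fun s =>
    Finset.sum_nonpos fun i _ => hy.term_nonpos hGCM (hyk s) i
  have hY : ∀ j, ∑ i, (∑ s, N k s / ε s * y s i) * A i j =
      ∑ t, N j t * ((∑ i, y t i * A i k) / ε t) := by
    intro j
    calc ∑ i, (∑ s, N k s / ε s * y s i) * A i j
        = ∑ s, N k s / ε s * ∑ i, y s i * A i j := by
          simp only [Finset.sum_mul, Finset.mul_sum]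
          rw [Finset.sum_comm]
          simp only [mul_assoc]
      _ = ∑ s, ∑ t, N k s * N j t * (B s t / ε s) := by
          simp only [hy.vecMul, Finset.mul_sum]
          refine Finset.sum_congr rfl fun s _ => Finset.sum_congr rfl fun t _ => ?_
          ring
      _ = ∑ t, ∑ s, N k s * N j t * (B t s / ε t) := by
          rw [Finset.sum_comm]
          refine Finset.sum_congr rfl fun t _ => Finset.sum_congr rfl fun s _ => ?_
          rw [(div_eq_div_iff (hε s).ne' (hε t).ne').mpr (hεB s t)]
      _ = _ := by
          simp only [hy.vecMul, Finset.mul_sum, Finset.sum_div]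
          refine Finset.sum_congr rfl fun t _ => Finset.sum_congr rfl fun s _ => ?_
          ring
  have hNnn : ∀ i s, (0 : ℝ) ≤ N i s := fun i s => by exact_mod_cast hN i s
  have hYj : ∀ j, ∑ i, (∑ s, N k s / ε s * y s i) * A i j ≤ 0 := fun j => by
    rw [hY]
    exact Finset.sum_nonpos fun t _ => mul_nonpos_of_nonneg_of_nonpos (hNnn j t)
      (div_nonpos_of_nonpos_of_nonneg (hb t) (hε t).le)
  have hterm : ∀ j, (∑ i, (∑ s, N k s / ε s * y s i) * A i j) * u j ≤ 0 := fun j =>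
    mul_nonpos_of_nonpos_of_nonneg (hYj j) (by exact_mod_cast hu.nonneg j)
  have hsum : 0 ≤ ∑ j, (∑ i, (∑ s, N k s / ε s * y s i) * A i j) * u j := by
    have h : ∑ j, (∑ i, (∑ s, N k s / ε s * y s i) * A i j) * (u j : ℝ) =
        ∑ i, (∑ s, N k s / ε s * y s i) * ∑ j, A i j * (u j : ℝ) := by
      simp only [Finset.sum_mul, Finset.mul_sum]
      rw [Finset.sum_comm]
      simp only [mul_assoc]
    rw [h]
    refine Finset.sum_nonneg fun i _ => ?_
    by_cases hik : i = k
    · simp [hik, hyk]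
    · refine mul_nonneg (Finset.sum_nonneg fun s _ => mul_nonneg
        (div_nonneg (hNnn k s) (hε s).le) (hy.nonneg s i)) ?_
      exact_mod_cast hu.2.2 i hik
  have hzero := (Finset.sum_eq_zero_iff_of_nonpos fun j _ => hterm j).mp
    (le_antisymm (Finset.sum_nonpos fun j _ => hterm j) hsum)
  have hbs : ∑ i, y s i * A i k = 0 := by
    obtain ⟨l, hl⟩ := hy.exists_eq s
    have hlk : l ≠ k := fun h => hk s (Or.inr (h ▸ hl))
    have h := (mul_eq_zero.mp (hzero l (Finset.mem_univ l))).resolve_right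
      (by exact_mod_cast (hu.1 l hlk).ne')
    rw [hY, hl, Finset.sum_eq_single s (by simp +contextual) (by simp)] at h
    simpa [(hε s).ne'] using h
  exact (Finset.sum_eq_zero_iff_of_nonpos fun i _ => hy.term_nonpos hGCM (hyk s) i).mp hbs i
    (Finset.mem_univ i)

/-- There are no imaginary vertices. -/
lemma exists_mem_resSet (hy : IsCorootFamily A B N y) (hGCM : IsGCM A) (hInd : Indecomposable A)
    (hSym : Symmetrizable A) (htype : IsFiniteType A ∨ IsAffineType A ∨ IsHyperbolic A)
    (hN : ∀ i, 0 ≤ N i) {k : I} (hk0 : N k ≠ 0) : ∃ s, N k = Pi.single s 1 := by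
  by_contra! hk
  have hkT : ∀ s, k ∉ resSet N s := fun s h => h.elim hk0 (hk s)
  obtain ⟨s₀, -⟩ := Function.ne_iff.mp hk0
  obtain ⟨l, hl⟩ := hy.exists_eq s₀
  obtain ⟨i, ⟨s, hi⟩, j, hj, hij⟩ := hInd {i | ∃ s, 0 < y s i} ⟨l, s₀, hy.pos s₀ l hl⟩
    ⟨k, fun ⟨s, hs⟩ => hs.ne' (hy.eq_zero s k (hkT s))⟩
  have hj0 : ∀ t, y t j = 0 := fun t =>
    le_antisymm (not_lt.mp fun h => hj ⟨t, h⟩) (hy.nonneg t j)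
  have hne : y s i * A i j ≠ 0 := mul_ne_zero hi.ne' (by exact_mod_cast hij)
  by_cases hjN : N j = 0
  · refine hne ((Finset.sum_eq_zero_iff_of_nonpos fun i _ =>
      hy.term_nonpos hGCM (hj0 s) i).mp ?_ i (Finset.mem_univ i))
    simp [hy.vecMul, hjN]
  · refine hne (hy.mul_eq_zero_of_imaginary hGCM hSym htype hN (fun t ht => ?_) s i)
    exact hj ⟨t, hy.pos t j (ht.resolve_left hjN)⟩

end IsCorootFamily

end NoImaginary

end KMG


open KMG

section Statement

attribute [local instance] Classical.propDecidable

variable {I : Type*} [Fintype I] [DecidableEq I] {A : Matrix I I ℤ}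
variable {g : Type*} [LieRing g] [LieAlgebra ℂ g]
variable {S : Type*} [Fintype S] [DecidableEq S] {B : Matrix S S ℤ}
variable {m : Type*} [LieRing m] [LieAlgebra ℂ m]

theorem statement13
    (hGCM : IsGCM A) (hInd : Indecomposable A) (hSym : Symmetrizable A)
    (G : KacMoodyAlgebra A g)
    (hBgcm : IsGCM B) (hBind : Indecomposable B)
    (M : KacMoodyAlgebra B m) (φ : m →ₗ⁅ℂ⁆ g)
    (hgr : IsFinGrading M φ) (hle : M.H.map φ.toLinearMap ≤ G.H)
    (hadapt : Adapted G M φ hle)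
    (htype : IsFiniteType A ∨ IsAffineType A ∨ IsHyperbolic A) :
    IpIm G M φ hle = ∅ ∧ CAdmissiblePair G (Jof G M φ hle) := by
  obtain ⟨N, hN⟩ := exists_isRes (hle := hle) hGCM hadapt
  obtain ⟨y, hy⟩ := hN.exists_isCorootFamily hgr hGCM hBgcm
  have him : ∀ k, k ∉ Jof G M φ hle → ∃ s, N k = Pi.single s 1 := fun k hk =>
    hy.exists_mem_resSet hGCM hInd hSym htype hN.1 fun h => hk (hN.mem_Jof.mpr h)
  refine ⟨Set.eq_empty_of_forall_notMem fun k hk => ?_, ?_⟩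
  · obtain ⟨s, hs⟩ := him k hk.1
    exact hk.2 s (hN.mem_GammaOf.mpr hs)
  · have hC : ∀ k : {k : I // k ∉ Jof G M φ hle},
        CAdmissibleComponent G (Jof G M φ hle) k.1 := fun k =>
      (him k.1 k.2).elim fun s hs => hN.cAdmissibleComponent hgr hGCM hBgcm hs
    choose hfin Hc hgen E F hE hF hsl ha using hC
    exact ⟨⟨hN.isFiniteType_Jof hgr hGCM, Hc, E, F, hfin, hgen, hE, hF, hsl, ha⟩⟩

end Statement
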